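/- arXiv:2204.00165 — 3 statements merged into one kernel-verified Lean document; each statement's English description precedes it below -/
import Mathlib

section
/- The number of permutations of the multiset {1,1,2,2,...,n,n} avoiding the patterns 1221 and 2112 equals n! · Cat_n = (2n)!/(n+1)!, where Cat_n is the n-th Catalan number. -/
attribute [local instance] Classical.propDecidable

/-- The word 1^k 2^k ... n^k. -/
def baseWord (n k : ℕ) : List ℕ := (List.range n).flatMap (fun i => List.replicate k (i+1))

/-- All permutations of the multiset with k copies of each of 1,...,n. -/
noncomputable def multiPerms (n k : ℕ) : Finset (List ℕ) := (baseWord n k).permutations.toFinset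

/-- Number of descents of a word. -/
def des (w : List ℕ) : ℕ := ((w.zip w.tail).filter (fun p => decide (p.2 < p.1))).length
/-- Number of plateaus of a word. -/
def plat (w : List ℕ) : ℕ := ((w.zip w.tail).filter (fun p => decide (p.2 = p.1))).length
/-- Number of weak descents of a word. -/
def wdes (w : List ℕ) : ℕ := ((w.zip w.tail).filter (fun p => decide (p.2 ≤ p.1))).length

/-- Avoidance of the patterns 1221 and 2112: there are no positions i < j < l < m with
w_i = w_m, w_j = w_l and w_i ≠ w_j. -/
def avoids (w : List ℕ) : Prop := ∀ i j l m, i < j → j < l → l < m → m < w.length →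
  w.getD i 0 = w.getD m 0 → w.getD j 0 = w.getD l 0 → w.getD i 0 = w.getD j 0

/-- Nonnesting permutations of the multiset {1,1,...,n,n}. -/
noncomputable def nonnest (n : ℕ) : Finset (List ℕ) := (multiPerms n 2).filter avoids

/-- Sublist version of avoidance. -/
def Av (w : List ℕ) : Prop := ∀ x y, List.Sublist [x, y, y, x] w → x = y

theorem avoids_iff_Av (w : List ℕ) : avoids w ↔ Av w := by
  constructor
  · intro h x y hs
    rw [List.sublist_iff_exists_fin_orderEmbedding_get_eq] at hs
    obtain ⟨f, hf⟩ := hs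
    have h0 := hf ⟨0, by simp⟩
    have h1 := hf ⟨1, by simp⟩
    have h2 := hf ⟨2, by simp⟩
    have h3 := hf ⟨3, by simp⟩
    have l01 : f ⟨0, by simp⟩ < f ⟨1, by simp⟩ := f.strictMono (by simp)
    have l12 : f ⟨1, by simp⟩ < f ⟨2, by simp⟩ := f.strictMono (by simp)
    have l23 : f ⟨2, by simp⟩ < f ⟨3, by simp⟩ := f.strictMono (by simp)
    have key := h _ _ _ _ l01 l12 l23 (f ⟨3, by simp⟩).2
    simp only [List.getD_eq_getElem?_getD, Fin.is_lt, getElem?_pos, Option.getD_some] at key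
    simp only [List.get_eq_getElem, List.getElem_cons_zero, List.getElem_cons_succ] at h0 h1 h2 h3
    rw [← h0, ← h1, ← h2, ← h3] at key
    exact key rfl rfl
  · intro h i j l m hij hjl hlm hm e1 e2
    have hl : l < w.length := by omega
    have hj : j < w.length := by omega
    have hi : i < w.length := by omega
    apply h
    have hp : ([⟨i, hi⟩, ⟨j, hj⟩, ⟨l, hl⟩, ⟨m, hm⟩] : List (Fin w.length)).Pairwise (· < ·) := by
      simp only [List.pairwise_cons, List.mem_cons, List.not_mem_nil, or_false, forall_eq_or_imp,
        forall_eq, Fin.mk_lt_mk]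
      refine ⟨⟨?_, ?_, ?_⟩, ⟨?_, ?_⟩, ?_, ?_⟩ <;> first | omega | simp
    have := List.map_getElem_sublist hp
    simp only [List.getD_eq_getElem?_getD, hi, hj, hl, hm, getElem?_pos, Option.getD_some] at e1 e2 ⊢
    simp only [List.map_cons, List.map_nil, Fin.getElem_fin] at this
    rw [← e1, ← e2] at this
    exact this

theorem Av_front (a : ℕ) (q w : List ℕ) (hq : q.Nodup) (haq : a ∉ q) (haw : a ∉ w) :
    Av (a :: q ++ a :: w) ↔ Av (q ++ w) := by
  constructor
  · intro h x y hs
    apply h x y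
    refine hs.trans ?_
    exact (List.Sublist.append (List.sublist_cons_self a q) (List.sublist_cons_self a w))
  · intro h x y hs
    by_contra hne
    by_cases hx : x = a
    · subst hx
      rw [List.cons_append, List.cons_sublist_cons, List.sublist_append_iff] at hs
      obtain ⟨l1, l2, e, h1, h2⟩ := hs
      rcases l1 with _ | ⟨b, _ | ⟨c, l1⟩⟩
      · simp at e
        subst e
        rcases List.sublist_cons_iff.1 h2 with h2 | ⟨r, hr, _⟩
        · exact haw (h2.subset (by simp))
        · simp at hr; exact hne hr.1.symm
      · simp at e
        obtain ⟨_, rfl⟩ := e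
        rcases List.sublist_cons_iff.1 h2 with h2 | ⟨r, hr, _⟩
        · exact haw (h2.subset (by simp))
        · simp at hr; exact hne hr.1.symm
      · simp at e
        obtain ⟨rfl, rfl, _⟩ := e
        have := h1.nodup hq
        simp at this
    by_cases hy : y = a
    · subst hy
      have := hs.count_le y
      have e := List.Sublist.filter (fun z => z = y ∨ z = x) hs
      rw [List.cons_append] at hs
      rcases List.sublist_cons_iff.1 hs with h2 | ⟨r, hr, _⟩
      · have := h2.count_le y
        simp [List.count_cons, List.count_eq_zero_of_not_mem haq, List.count_eq_zero_of_not_mem haw, hx] at this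
      · simp at hr; exact hne hr.1
    · have e := List.Sublist.filter (fun z => decide (z ≠ a)) hs
      apply hne
      apply h
      have f1 : q.filter (fun z => decide (z ≠ a)) = q := by
        rw [List.filter_eq_self]; intro z hz; simp; rintro rfl; exact haq hz
      have f2 : w.filter (fun z => decide (z ≠ a)) = w := by
        rw [List.filter_eq_self]; intro z hz; simp; rintro rfl; exact haw hz
      rw [List.filter_append, List.filter_cons_of_neg (a := a) (l := q) (by simp),
        List.filter_cons_of_neg (a := a) (l := w) (by simp), f1, f2] at e
      simpa [hx, hy] using e

/-- Completions `w` of the queue state `q` with unused letters `r`. -/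
noncomputable def TT (q r : List ℕ) : Finset (List ℕ) :=
  (q ++ r ++ r).permutations.toFinset.filter (fun w => Av (q ++ w))

theorem mem_TT (q r w : List ℕ) : w ∈ TT q r ↔ w.Perm (q ++ r ++ r) ∧ Av (q ++ w) := by
  simp [TT]

theorem mem_TT_new (q r w : List ℕ) (x : ℕ) (hx : x ∈ r) :
    x :: w ∈ TT q r ↔ w ∈ TT (q ++ [x]) (r.erase x) := by
  rw [mem_TT, mem_TT]
  have e : q ++ x :: w = q ++ [x] ++ w := by simp
  rw [e]
  refine and_congr_left fun _ => ?_
  have p := List.perm_cons_erase hx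
  have p2 : (q ++ r ++ r).Perm (x :: (q ++ [x] ++ r.erase x ++ r.erase x)) := by
    refine ((p.append_left q).append p).trans ?_
    rw [List.perm_iff_count]
    intro a
    simp [List.count_append, List.count_cons]
    omega
  constructor
  · intro h
    exact (h.trans p2).cons_inv
  · intro h
    exact (h.cons x).trans p2.symm

theorem mem_TT_front (a : ℕ) (q r w : List ℕ) (hn : (a :: q ++ r).Nodup) :
    a :: w ∈ TT (a :: q) r ↔ w ∈ TT q r := by
  rw [mem_TT, mem_TT]
  have e : a :: q ++ r ++ r = a :: (q ++ r ++ r) := by simp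
  rw [e, List.perm_cons]
  refine and_congr_right fun hp => ?_
  rw [List.cons_append, List.nodup_cons] at hn
  have h1 := hn.1
  simp only [List.mem_append, not_or] at h1
  apply Av_front _ _ _ (List.nodup_append.1 hn.2).1 h1.1
  rw [hp.mem_iff]
  simp [h1.1, h1.2]

theorem head_TT (q r w : List ℕ) (x : ℕ) (hxr : x ∉ r)
    (h : x :: w ∈ TT q r) : ∃ q', q = x :: q' := by
  rw [mem_TT] at h
  have hx : x ∈ q := by
    have : x ∈ q ++ r ++ r := h.1.subset (by simp)
    simpa [hxr] using this
  rcases q with _ | ⟨a, q⟩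
  · simp at hx
  · by_cases hax : a = x
    · subst hax; exact ⟨q, rfl⟩
    · exfalso
      have hxq : x ∈ q := by
        rcases List.mem_cons.1 hx with h | h
        · exact absurd h.symm hax
        · exact h
      have haw : a ∈ w := by
        have : a ∈ x :: w := h.1.symm.subset (by simp)
        simpa [hax] using this
      apply hax
      apply h.2
      have s1 : List.Sublist [x] q := by simpa using hxq
      have s2 : List.Sublist [a] w := by simpa using haw
      exact (s1.cons_cons a).append (s2.cons_cons x)

/-- Words starting with a new letter. -/
noncomputable def newPart (q r : List ℕ) : Finset (List ℕ) :=
  r.toFinset.biUnion fun x => (TT (q ++ [x]) (r.erase x)).image (List.cons x)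

theorem card_newPart (q r : List ℕ) :
    (newPart q r).card = ∑ x ∈ r.toFinset, (TT (q ++ [x]) (r.erase x)).card := by
  rw [newPart, Finset.card_biUnion]
  · refine Finset.sum_congr rfl fun x _ => ?_
    exact Finset.card_image_of_injective _ List.cons_injective
  · intro x _ y _ hxy
    rw [Function.onFun, Finset.disjoint_left]
    intro w hw hw'
    simp only [Finset.mem_image] at hw hw'
    obtain ⟨u, _, rfl⟩ := hw
    obtain ⟨v, _, e⟩ := hw'
    simp at e
    exact hxy e.1.symm

theorem mem_newPart (q r w : List ℕ) : w ∈ newPart q r ↔ ∃ x v, x ∈ r ∧ w = x :: v ∧ w ∈ TT q r := by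
  simp only [newPart, Finset.mem_biUnion, Finset.mem_image, List.mem_toFinset]
  constructor
  · rintro ⟨x, hx, v, hv, rfl⟩
    exact ⟨x, v, hx, rfl, (mem_TT_new q r v x hx).2 hv⟩
  · rintro ⟨x, v, hx, rfl, h⟩
    exact ⟨x, hx, v, (mem_TT_new q r v x hx).1 h, rfl⟩

theorem TT_nil (r : List ℕ) (hr : r ≠ []) : TT [] r = newPart [] r := by
  ext w
  rw [mem_newPart]
  constructor
  · intro h
    rcases w with _ | ⟨x, v⟩
    · rw [mem_TT] at h
      have := h.1.length_eq
      have := List.length_pos_iff.2 hr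
      simp at *
      omega
    · refine ⟨x, v, ?_, rfl, h⟩
      by_contra hx
      obtain ⟨q', hq⟩ := head_TT _ _ _ _ hx h
      simp at hq
  · rintro ⟨_, _, _, _, h⟩
    exact h

theorem TT_cons (a : ℕ) (q r : List ℕ) (hn : (a :: q ++ r).Nodup) :
    TT (a :: q) r = newPart (a :: q) r ∪ (TT q r).image (List.cons a) := by
  ext w
  rw [Finset.mem_union, mem_newPart, Finset.mem_image]
  constructor
  · intro h
    rcases w with _ | ⟨x, v⟩
    · rw [mem_TT] at h
      have := h.1.length_eq
      simp at this
    · by_cases hx : x ∈ r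
      · exact Or.inl ⟨x, v, hx, rfl, h⟩
      · obtain ⟨q', hq⟩ := head_TT _ _ _ _ hx h
        simp at hq
        obtain ⟨rfl, rfl⟩ := hq
        exact Or.inr ⟨v, (mem_TT_front _ _ _ _ hn).1 h, rfl⟩
  · rintro (⟨_, _, _, _, h⟩ | ⟨v, hv, rfl⟩)
    · exact h
    · exact (mem_TT_front _ _ _ _ hn).2 hv

theorem card_TT_cons (a : ℕ) (q r : List ℕ) (hn : (a :: q ++ r).Nodup) :
    (TT (a :: q) r).card = (newPart (a :: q) r).card + (TT q r).card := by
  rw [TT_cons a q r hn, Finset.card_union_of_disjoint,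
    Finset.card_image_of_injective _ List.cons_injective]
  rw [Finset.disjoint_left]
  intro w hw hw'
  rw [mem_newPart] at hw
  rw [Finset.mem_image] at hw'
  obtain ⟨x, v, hx, rfl, _⟩ := hw
  obtain ⟨u, _, e⟩ := hw'
  simp at e
  rw [List.cons_append, List.nodup_cons] at hn
  apply hn.1
  rw [e.1]
  simp [hx]

theorem card_TT (N : ℕ) : ∀ q r : List ℕ, q.length + 2 * r.length = N → (q ++ r).Nodup →
    (TT q r).card * (q.length + r.length + 1).factorial = (q.length + 1) * N.factorial := by
  induction N with
  | zero =>
    intro q r h _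
    have hq : q = [] := List.length_eq_zero_iff.1 (by omega)
    have hr : r = [] := List.length_eq_zero_iff.1 (by omega)
    subst hq hr
    have : TT [] [] = {[]} := by
      ext w
      rw [mem_TT]
      simp
      rintro rfl x y h
      simp at h
    simp [this]
  | succ N ih =>
    intro q r h hn
    have hnew : (newPart q r).card * (q.length + r.length + 1).factorial
        = r.length * ((q.length + 2) * N.factorial) := by
      rw [card_newPart, Finset.sum_mul]
      have : ∀ x ∈ r.toFinset, (TT (q ++ [x]) (r.erase x)).card *
          (q.length + r.length + 1).factorial = (q.length + 2) * N.factorial := by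
        intro x hx
        rw [List.mem_toFinset] at hx
        have hl := List.length_erase_of_mem hx
        have hpos := List.length_pos_of_mem hx
        have := ih (q ++ [x]) (r.erase x) (by simp [hl]; omega) (by
          refine (List.Perm.nodup_iff ?_).1 hn
          rw [List.append_assoc]
          exact (List.perm_cons_erase hx).append_left q)
        rw [List.length_append, List.length_singleton, hl] at this
        rw [← this]
        congr 2
        omega
      rw [Finset.sum_congr rfl this, Finset.sum_const, smul_eq_mul,
        List.toFinset_card_of_nodup (List.nodup_append.1 hn).2.1]
    rcases q with _ | ⟨a, q⟩
    · rw [TT_nil r (by rintro rfl; simp at h), hnew, Nat.factorial_succ, ← h]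
      simp
      ring
    · rw [card_TT_cons a q r hn, add_mul, hnew]
      have h2 := ih q r (by simp at h; omega) (by
        rw [List.cons_append, List.nodup_cons] at hn; exact hn.2)
      simp only [List.length_cons] at h ⊢
      have e : q.length + 1 + r.length + 1 = (q.length + r.length + 1) + 1 := by ring
      rw [e, Nat.factorial_succ (q.length + r.length + 1), Nat.factorial_succ N, ← h]
      rw [mul_left_comm (TT q r).card, h2]
      ring

theorem baseWord_perm (n : ℕ) :
    (baseWord n 2).Perm ((List.range n).map (· + 1) ++ (List.range n).map (· + 1)) := by
  have : ∀ l : List ℕ, (l.flatMap (fun i => List.replicate 2 (i+1))).Perm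
      (l.map (· + 1) ++ l.map (· + 1)) := by
    intro l
    induction l with
    | nil => simp
    | cons a l ih =>
      rw [List.perm_iff_count] at ih ⊢
      intro b
      have := ih b
      simp only [List.flatMap_cons, List.map_cons, List.count_append, List.count_cons,
        List.count_replicate] at this ⊢
      split_ifs <;> omega
  exact this _

theorem nonnest_eq (n : ℕ) : nonnest n = TT [] ((List.range n).map (· + 1)) := by
  ext w
  rw [mem_TT, nonnest, Finset.mem_filter, avoids_iff_Av, multiPerms, List.mem_toFinset,
    List.mem_permutations]
  simp only [List.nil_append]
  rw [(baseWord_perm n).congr_right w]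

/-- The number of nonnesting permutations of {1,1,...,n,n} is n! · Cat_n = (2n)!/(n+1)!. -/
theorem card_nonnest (n : ℕ) :
    (nonnest n).card = n.factorial * catalan n ∧
    (nonnest n).card = (2 * n).factorial / (n + 1).factorial := by
  have h := card_TT (2 * n) [] ((List.range n).map (· + 1)) (by simp) (by
    simp only [List.nil_append]
    exact List.nodup_range.map (add_left_injective 1))
  rw [← nonnest_eq] at h
  simp at h
  have h2 : n.factorial * catalan n * (n + 1).factorial = (2 * n).factorial := by
    have h3 := Nat.centralBinom_eq_two_mul_choose n
    have h4 := succ_mul_catalan_eq_centralBinom n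
    have h5 := Nat.choose_mul_factorial_mul_factorial (show n ≤ 2 * n by omega)
    rw [← h3, ← h4, show 2 * n - n = n by omega] at h5
    rw [← h5, Nat.factorial_succ]
    ring
  have hp := Nat.factorial_pos (n + 1)
  constructor
  · exact Nat.eq_of_mul_eq_mul_right hp (h.trans h2.symm)
  · rw [← h, Nat.mul_div_cancel _ hp]
end

section
/- For n ≥ 1, the bivariate descent–plateau polynomial of nonnesting permutations factors as C_n(t,u) = A_n(t) · N_n(t,u), where A_n is the Eulerian polynomial and N_n(t,u) = Σ_{D ∈ D_n} t^{hpea(D)} u^{lpea(D)} is the Narayana polynomial counting Dyck paths by high and low peaks. -/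
attribute [local instance] Classical.propDecidable

/-- Dyck words: E = true, N = false, n steps of each kind, every prefix staying
weakly below the diagonal. -/
noncomputable def dyckWords (n : ℕ) : Finset (List Bool) :=
  ((List.replicate n true ++ List.replicate n false).permutations.toFinset).filter
    (fun s => ∀ k, (s.take k).count false ≤ (s.take k).count true)

/-- A peak is a consecutive EN pair. -/
def isPeak (s : List Bool) (i : ℕ) : Prop :=
  i + 1 < s.length ∧ s.getD i false = true ∧ s.getD (i+1) true = false

/-- A low peak is a peak touching the diagonal. -/
def isLowPeak (s : List Bool) (i : ℕ) : Prop :=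
  isPeak s i ∧ (s.take (i+1)).count true = (s.take (i+1)).count false + 1

/-- Number of peaks. -/
noncomputable def pea (s : List Bool) : ℕ :=
  ((Finset.range s.length).filter (fun i => isPeak s i)).card
/-- Number of low peaks. -/
noncomputable def lpea (s : List Bool) : ℕ :=
  ((Finset.range s.length).filter (fun i => isLowPeak s i)).card
/-- Number of high peaks. -/
noncomputable def hpea (s : List Bool) : ℕ :=
  ((Finset.range s.length).filter (fun i => isPeak s i ∧ ¬ isLowPeak s i)).card


/-- Bivariate Narayana polynomial N_n(t,u), t = X 0, u = X 1. -/
noncomputable def Npoly (n : ℕ) : MvPolynomial (Fin 2) ℚ :=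
  ∑ D ∈ dyckWords n, (MvPolynomial.X 0) ^ hpea D * (MvPolynomial.X 1) ^ lpea D

/-! ### Basic facts on descents -/

theorem des_cons_cons (x y : ℕ) (r : List ℕ) :
    des (x :: y :: r) = (if y < x then 1 else 0) + des (y :: r) := by
  by_cases h : y < x
  · simp [des, h, Nat.add_comm]
  · simp [des, h]

theorem des_single (x : ℕ) : des [x] = 0 := by simp [des]

theorem des_nil : des [] = 0 := by simp [des]

theorem des_split (P : List ℕ) (x : ℕ) (Q : List ℕ) :
    des (P ++ x :: Q) = des (P ++ [x]) + des (x :: Q) := by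
  induction P with
  | nil => simp [des_single]
  | cons a P ih =>
    cases P with
    | nil => simp [des_cons_cons, des_single]
    | cons b P =>
      simp only [List.cons_append, des_cons_cons] at ih ⊢
      omega

theorem des_map_congr (v v' : ℕ → ℕ) (w : List ℕ)
    (h : ∀ P x y Q, w = P ++ x :: y :: Q → (v y < v x ↔ v' y < v' x)) :
    des (w.map v) = des (w.map v') := by
  induction w with
  | nil => rfl
  | cons a w ih =>
    cases w with
    | nil => simp [des_single]
    | cons b w =>
      have h1 := h [] a b w rfl
      have h2 := ih (fun P x y Q e => h (a :: P) x y Q (by simp [e]))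
      simp only [List.map_cons, des_cons_cons] at h2 ⊢
      rw [h2]
      simp only [h1]

theorem filter_zip_card (r : ℕ × ℕ → Prop) [DecidablePred r] (w : List ℕ) :
    ((w.zip w.tail).filter (fun p => decide (r p))).length =
      ((Finset.range w.length).filter
        (fun i => i + 1 < w.length ∧ r (w.getD i 0, w.getD (i+1) 0))).card := by
  induction w with
  | nil => simp
  | cons a w ih =>
    cases w with
    | nil => simp
    | cons b w =>
      rw [Finset.card_filter] at ih ⊢
      rw [List.length_cons, Finset.sum_range_succ']
      simp only [List.tail_cons, List.zip_cons_cons, List.filter_cons] at ih ⊢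
      by_cases h : r (a, b)
      · simp only [h, decide_true, if_true, List.length_cons] at ih ⊢
        rw [ih]
        simp [h]
      · simp only [h, decide_false] at ih ⊢
        simp only [Bool.false_eq_true, if_false]
        rw [ih]
        simp [h]

/-! ### Labelling a lattice word -/

/-- Indices of the steps: the i-th E and the i-th N (from 0) both get label i. -/
def lab : ℕ → ℕ → List Bool → List ℕ
  | _, _, [] => []
  | a, b, true :: s => a :: lab (a+1) b s
  | a, b, false :: s => b :: lab a (b+1) s

theorem lab_append (a b : ℕ) (A C : List Bool) :
    lab a b (A ++ C) = lab a b A ++ lab (a + A.count true) (b + A.count false) C := by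
  induction A generalizing a b with
  | nil => simp [lab]
  | cons c A ih =>
    cases c <;> simp [lab, ih] <;> congr 1 <;> omega

theorem lab_length (a b : ℕ) (s : List Bool) : (lab a b s).length = s.length := by
  induction s generalizing a b with
  | nil => rfl
  | cons c s ih => cases c <;> simp [lab, ih]

theorem lab_split (a b : ℕ) (s : List Bool) (P R : List ℕ) (h : lab a b s = P ++ R) :
    ∃ A C, s = A ++ C ∧ lab a b A = P ∧ lab (a + A.count true) (b + A.count false) C = R := by
  refine ⟨s.take P.length, s.drop P.length, by simp, ?_⟩
  have h1 := lab_append a b (s.take P.length) (s.drop P.length)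
  rw [List.take_append_drop, h] at h1
  have hl : P.length ≤ s.length := by
    have := congrArg List.length h
    rw [lab_length, List.length_append] at this
    omega
  have := List.append_inj h1 (by rw [lab_length, List.length_take]; omega)
  exact ⟨this.1.symm, this.2.symm⟩

theorem lab_mem (a b : ℕ) (s : List Bool) (x : ℕ) (h : x ∈ lab a b s) :
    x < a + s.count true ∨ x < b + s.count false := by
  induction s generalizing a b with
  | nil => simp [lab] at h
  | cons c s ih =>
    cases c
    · simp only [lab, List.mem_cons] at h
      simp only [List.count_cons]
      rcases h with h | h
      · right; simp; omega
      · have := ih _ _ h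
        simp; omega
    · simp only [lab, List.mem_cons] at h
      simp only [List.count_cons]
      rcases h with h | h
      · left; simp; omega
      · have := ih _ _ h
        simp; omega

theorem lab_getD (a b : ℕ) (s : List Bool) (i : ℕ) (h : i < s.length) :
    (lab a b s).getD i 0 =
      if s.getD i false = true then a + (s.take i).count true else b + (s.take i).count false := by
  induction s generalizing a b i with
  | nil => simp at h
  | cons c s ih =>
    cases i with
    | zero => cases c <;> simp [lab]
    | succ i =>
      have h' : i < s.length := by simpa using h
      cases c
      · simp only [lab, List.getD_cons_succ, List.take_succ_cons, ih _ _ _ h']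
        simp
        split_ifs <;> omega
      · simp only [lab, List.getD_cons_succ, List.take_succ_cons, ih _ _ _ h']
        simp
        split_ifs <;> omega

theorem mem_dyck (n : ℕ) (s : List Bool) : s ∈ dyckWords n ↔
    s.count true = n ∧ s.count false = n ∧
      ∀ k, (s.take k).count false ≤ (s.take k).count true := by
  simp only [dyckWords, Finset.mem_filter, List.mem_toFinset, List.mem_permutations]
  rw [← and_assoc]
  refine and_congr_left fun _ => ?_
  rw [List.perm_iff_count]
  constructor
  · intro h
    have h1 := h true
    have h2 := h false
    simp [List.count_replicate] at h1 h2
    exact ⟨h1, h2⟩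
  · rintro ⟨h1, h2⟩ b
    cases b <;> simp [List.count_replicate, h1, h2]

theorem count_take_succ (s : List Bool) (i : ℕ) (h : i < s.length) (c : Bool) :
    (s.take (i+1)).count c = (s.take i).count c + if s.getD i false = c then 1 else 0 := by
  rw [List.take_succ_eq_append_getElem h, List.count_append]
  simp [List.count_cons, List.getD_eq_getElem?_getD, h]

theorem getD_default (s : List Bool) (i : ℕ) (h : i < s.length) :
    s.getD i true = s.getD i false := by
  simp [List.getD_eq_getElem?_getD, h]

theorem des_lab_id (n : ℕ) (s : List Bool) (hs : s ∈ dyckWords n) :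
    des (lab 0 0 s) = hpea s := by
  rw [mem_dyck] at hs
  obtain ⟨-, -, hs⟩ := hs
  unfold des hpea
  rw [filter_zip_card (fun p => p.2 < p.1), lab_length]
  congr 1
  apply Finset.filter_congr
  intro i hi
  by_cases h : i + 1 < s.length
  · have hi' : i < s.length := by omega
    have c1 := count_take_succ s i hi' true
    have c2 := count_take_succ s i hi' false
    have c3 := hs i
    have c4 := hs (i+1)
    simp only [isLowPeak, isPeak, h, lab_getD _ _ _ _ h, lab_getD _ _ _ _ hi', getD_default _ _ h,
      true_and, c1, c2] at c4 ⊢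
    cases h1 : s.getD i false <;> cases h2 : s.getD (i+1) false <;>
      simp only [h1, h2] at c4 ⊢ <;> simp at c4 ⊢ <;> omega
  · simp [isPeak, h]

theorem plat_lab (n : ℕ) (s : List Bool) (hs : s ∈ dyckWords n) :
    plat (lab 0 0 s) = lpea s := by
  rw [mem_dyck] at hs
  obtain ⟨-, -, hs⟩ := hs
  unfold plat lpea
  rw [filter_zip_card (fun p => p.2 = p.1), lab_length]
  congr 1
  apply Finset.filter_congr
  intro i hi
  by_cases h : i + 1 < s.length
  · have hi' : i < s.length := by omega
    have c1 := count_take_succ s i hi' true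
    have c2 := count_take_succ s i hi' false
    have c3 := hs i
    have c4 := hs (i+1)
    simp only [isLowPeak, isPeak, h, lab_getD _ _ _ _ h, lab_getD _ _ _ _ hi', getD_default _ _ h,
      true_and, c1, c2] at c4 ⊢
    cases h1 : s.getD i false <;> cases h2 : s.getD (i+1) false <;>
      simp only [h1, h2] at c4 ⊢ <;> simp at c4 ⊢ <;> omega
  · simp [isLowPeak, isPeak, h]

theorem plat_map (v : ℕ → ℕ) (w : List ℕ) (h : ∀ x ∈ w, ∀ y ∈ w, v x = v y → x = y) :
    plat (w.map v) = plat w := by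
  unfold plat
  rw [← List.map_tail, List.zip_map, List.filter_map, List.length_map]
  congr 1
  apply List.filter_congr
  rintro ⟨x, y⟩ hp
  have hx := (List.of_mem_zip hp).1
  have hy := List.mem_of_mem_tail (List.of_mem_zip hp).2
  simp only [Function.comp, Prod.map]
  rw [decide_eq_decide]
  exact ⟨h y hy x hx, fun e => by rw [e]⟩

/-! ### The invariant for a fixed linear order of the indices -/

/-- The factorization for a fixed valuation of the indices. -/
def GoodV (n : ℕ) (v : ℕ → ℕ) : Prop :=
  (∑ D ∈ dyckWords n, (MvPolynomial.X 0 : MvPolynomial (Fin 2) ℚ) ^ des ((lab 0 0 D).map v) *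
      (MvPolynomial.X 1) ^ plat (lab 0 0 D))
    = (MvPolynomial.X 0) ^ des ((List.range n).map v) * Npoly n

/-- The valuation given by the position in a list. -/
def GoodL (n : ℕ) (l : List ℕ) : Prop := GoodV n (fun i => l.idxOf i)

theorem lab_mem_lt (n : ℕ) (D : List Bool) (hD : D ∈ dyckWords n) (x : ℕ) (h : x ∈ lab 0 0 D) :
    x < n := by
  rw [mem_dyck] at hD
  have := lab_mem _ _ _ _ h
  omega

theorem goodV_congr (n : ℕ) (v v' : ℕ → ℕ)
    (h : ∀ x < n, ∀ y < n, (v x < v y ↔ v' x < v' y)) : GoodV n v ↔ GoodV n v' := by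
  unfold GoodV
  have h1 : des ((List.range n).map v) = des ((List.range n).map v') := by
    apply des_map_congr
    intro P x y Q e
    have hx : x ∈ List.range n := by rw [e]; simp
    have hy : y ∈ List.range n := by rw [e]; simp
    exact h y (List.mem_range.1 hy) x (List.mem_range.1 hx)
  have h2 : ∀ D ∈ dyckWords n, des ((lab 0 0 D).map v) = des ((lab 0 0 D).map v') := by
    intro D hD
    apply des_map_congr
    intro P x y Q e
    have hx : x ∈ lab 0 0 D := by rw [e]; simp
    have hy : y ∈ lab 0 0 D := by rw [e]; simp
    exact h y (lab_mem_lt n D hD y hy) x (lab_mem_lt n D hD x hx)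
  rw [h1, Finset.sum_congr rfl (fun D hD => by rw [h2 D hD])]

theorem range_pairs (n : ℕ) (P : List ℕ) (x y : ℕ) (Q : List ℕ)
    (e : List.range n = P ++ x :: y :: Q) : y = x + 1 := by
  have h1 : (List.range n)[P.length]? = some x := by rw [e]; simp
  have h2 : (List.range n)[P.length + 1]? = some y := by
    rw [e, List.getElem?_append_right (by omega)]; simp
  rw [List.getElem?_eq_some_iff] at h1 h2
  obtain ⟨_, h1⟩ := h1
  obtain ⟨_, h2⟩ := h2
  simp at h1 h2
  omega

theorem goodV_id (n : ℕ) : GoodV n id := by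
  unfold GoodV
  have h1 : des ((List.range n).map id) = 0 := by
    have : des ((List.range n).map id) = des ((List.range n).map (fun _ => 0)) := by
      apply des_map_congr
      intro P x y Q e
      have := range_pairs n P x y Q e
      simp; omega
    rw [this]
    generalize List.range n = w
    induction w with
    | nil => simp [des_nil]
    | cons a w ih =>
      cases w with
      | nil => simp [des_single]
      | cons b w =>
        simp only [List.map_cons, des_cons_cons] at ih ⊢
        simpa using ih
  rw [h1, pow_zero, one_mul, Npoly]
  apply Finset.sum_congr rfl
  intro D hD
  rw [List.map_id, des_lab_id n D hD, plat_lab n D hD]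

/-! ### Rotation -/

theorem des_rot (v v' : ℕ → ℕ) (x : ℕ) (w : List ℕ)
    (h1 : ∀ y ∈ w, y ≠ x → v x < v y) (h2 : ∀ y ∈ w, y ≠ x → v' y < v' x)
    (h3 : ∀ y ∈ w, ∀ z ∈ w, y ≠ x → z ≠ x → (v y < v z ↔ v' y < v' z)) :
    des (w.map v) + (if w.head? = some x then 1 else 0) =
      des (w.map v') + (if w.getLast? = some x then 1 else 0) := by
  induction w with
  | nil => simp [des_nil]
  | cons a w ih =>
    cases w with
    | nil => simp [des_single]
    | cons b w =>
      have ih' := ih (fun y hy => h1 y (List.mem_cons_of_mem _ hy))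
        (fun y hy => h2 y (List.mem_cons_of_mem _ hy))
        (fun y hy z hz => h3 y (List.mem_cons_of_mem _ hy) z (List.mem_cons_of_mem _ hz))
      simp only [List.map_cons, des_cons_cons, List.getLast?_cons_cons] at ih' ⊢
      simp only [List.head?_cons, Option.some.injEq] at ih' ⊢
      have ha1 := h1 a (by simp)
      have ha2 := h2 a (by simp)
      have hb1 := h1 b (by simp)
      have hb2 := h2 b (by simp)
      have h3' := h3 b (by simp) a (by simp)
      by_cases ha : a = x
      · by_cases hb : b = x
        · subst ha; subst hb
          simp at ih' ⊢
          omega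
        · subst ha
          have := hb1 hb
          have := hb2 hb
          rw [if_neg (by omega : ¬ v b < v a), if_pos (by omega : v' b < v' a), if_pos rfl]
          rw [if_neg hb] at ih'
          omega
      · by_cases hb : b = x
        · subst hb
          have := ha1 ha
          have := ha2 ha
          rw [if_pos (by omega : v b < v a), if_neg (by omega : ¬ v' b < v' a), if_neg ha]
          rw [if_pos rfl] at ih'
          omega
        · have := h3' hb ha
          rw [if_neg ha]
          rw [if_neg hb] at ih'
          simp only [this]
          omega

theorem lab_head (n : ℕ) (hn : 1 ≤ n) (D : List Bool) (hD : D ∈ dyckWords n) :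
    (lab 0 0 D).head? = some 0 := by
  rw [mem_dyck] at hD
  cases D with
  | nil => simp at hD; omega
  | cons c D => cases c <;> simp [lab]

theorem lab_last (n : ℕ) (hn : 1 ≤ n) (D : List Bool) (hD : D ∈ dyckWords n) :
    (lab 0 0 D).getLast? = some (n - 1) := by
  rw [mem_dyck] at hD
  obtain ⟨h1, h2, h3⟩ := hD
  rcases List.eq_nil_or_concat D with rfl | ⟨A, c, rfl⟩
  · simp at h1; omega
  · have h4 := h3 A.length
    simp at h4
    cases c
    · simp [List.count_append] at h1 h2
      rw [List.concat_eq_append, lab_append]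
      simp [lab]
      omega
    · simp [List.count_append] at h1 h2
      omega

theorem good_rot (n : ℕ) (hn : 1 ≤ n) (x : ℕ) (l : List ℕ) (hp : (x :: l).Perm (List.range n)) :
    GoodL n (x :: l) ↔ GoodL n (l ++ [x]) := by
  have hnd : (x :: l).Nodup := hp.nodup_iff.2 List.nodup_range
  have hxl : x ∉ l := (List.nodup_cons.1 hnd).1
  have hmem : ∀ y < n, y ≠ x → y ∈ l := by
    intro y hy hyx
    have : y ∈ x :: l := hp.mem_iff.2 (List.mem_range.2 hy)
    simpa [hyx] using this
  unfold GoodL GoodV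
  set v : ℕ → ℕ := fun i => (x :: l).idxOf i with hv
  set v' : ℕ → ℕ := fun i => (l ++ [x]).idxOf i with hv'
  have e1 : v x = 0 := by simp [hv]
  have e2 : ∀ y < n, y ≠ x → v y = l.idxOf y + 1 := by
    intro y hy hyx
    simp [hv, List.idxOf_cons_ne _ hyx.symm]
  have e3 : v' x = l.length := by
    simp [hv', List.idxOf_append_of_notMem hxl]
  have e4 : ∀ y < n, y ≠ x → v' y = l.idxOf y := by
    intro y hy hyx
    simp [hv', List.idxOf_append_of_mem (hmem y hy hyx)]
  have e5 : ∀ y < n, y ≠ x → l.idxOf y < l.length := by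
    intro y hy hyx
    exact List.idxOf_lt_length_of_mem (hmem y hy hyx)
  have key : ∀ w : List ℕ, (∀ y ∈ w, y < n) → w.head? = some 0 → w.getLast? = some (n-1) →
      des (w.map v) + (if 0 = x then 1 else 0) = des (w.map v') + (if n - 1 = x then 1 else 0) := by
    intro w hw hh hl
    have := des_rot v v' x w
      (by intro y hy hyx; rw [e1, e2 y (hw y hy) hyx]; omega)
      (by intro y hy hyx; rw [e3, e4 y (hw y hy) hyx]; exact e5 y (hw y hy) hyx)
      (by intro y hy z hz hyx hzx
          rw [e2 y (hw y hy) hyx, e2 z (hw z hz) hzx, e4 y (hw y hy) hyx, e4 z (hw z hz) hzx]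
          omega)
    rw [hh, hl] at this
    simpa using this
  have k1 := key (List.range n) (fun y hy => List.mem_range.1 hy)
    (by cases n with
        | zero => omega
        | succ n => simp [List.range_succ_eq_map])
    (by cases n with
        | zero => omega
        | succ n => simp [List.range_succ])
  have k2 : ∀ D ∈ dyckWords n, _ := fun D hD => key (lab 0 0 D) (lab_mem_lt n D hD)
    (lab_head n hn D hD) (lab_last n hn D hD)
  set c := (if 0 = x then 1 else 0) with hc
  set d := (if n - 1 = x then 1 else 0) with hd
  have hX : (MvPolynomial.X 0 : MvPolynomial (Fin 2) ℚ) ≠ 0 := MvPolynomial.X_ne_zero 0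
  have hS : (MvPolynomial.X 0 : MvPolynomial (Fin 2) ℚ) ^ c *
      (∑ D ∈ dyckWords n, (MvPolynomial.X 0 : MvPolynomial (Fin 2) ℚ) ^ des ((lab 0 0 D).map v) *
      (MvPolynomial.X 1) ^ plat (lab 0 0 D)) = (MvPolynomial.X 0 : MvPolynomial (Fin 2) ℚ) ^ d *
      (∑ D ∈ dyckWords n, (MvPolynomial.X 0 : MvPolynomial (Fin 2) ℚ) ^ des ((lab 0 0 D).map v') *
      (MvPolynomial.X 1) ^ plat (lab 0 0 D)) := by
    rw [Finset.mul_sum, Finset.mul_sum]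
    apply Finset.sum_congr rfl
    intro D hD
    rw [← mul_assoc, ← mul_assoc, ← pow_add, ← pow_add, add_comm c, add_comm d, k2 D hD]
  have hR : (MvPolynomial.X 0 : MvPolynomial (Fin 2) ℚ) ^ c *
      ((MvPolynomial.X 0) ^ des ((List.range n).map v) * Npoly n) =
      (MvPolynomial.X 0 : MvPolynomial (Fin 2) ℚ) ^ d *
      ((MvPolynomial.X 0) ^ des ((List.range n).map v') * Npoly n) := by
    rw [← mul_assoc, ← mul_assoc, ← pow_add, ← pow_add, add_comm c, add_comm d, k1]
  rw [← mul_right_inj' (pow_ne_zero c hX), hS, hR, mul_right_inj' (pow_ne_zero d hX)]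

/-! ### Swapping two consecutive values at non-adjacent positions -/

/-- Exchange the steps E_j and N_i when they are adjacent. -/
def flip2 (i j : ℕ) (D : List Bool) : List Bool :=
  if (D.take (i+j)).count true = j then
    match D.drop (i+j) with
    | true :: false :: C => D.take (i+j) ++ false :: true :: C
    | false :: true :: C => D.take (i+j) ++ true :: false :: C
    | _ => D
  else D

theorem count_tf (A : List Bool) : A.count true + A.count false = A.length := by
  induction A with
  | nil => rfl
  | cons c A ih => cases c <;> simp <;> omega

theorem flip2_eq (i j : ℕ) (A C : List Bool) (c : Bool) (h1 : A.count true = j)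
    (h2 : A.count false = i) : flip2 i j (A ++ c :: (!c) :: C) = A ++ (!c) :: c :: C := by
  have hl : A.length = i + j := by have := count_tf A; omega
  unfold flip2
  rw [← hl, List.take_left, List.drop_left, if_pos h1]
  cases c <;> rfl

theorem flip2_cases (i j : ℕ) (D : List Bool) :
    (∃ A c C, D = A ++ c :: (!c) :: C ∧ A.count true = j ∧ A.count false = i) ∨
    (flip2 i j D = D ∧
      ¬ ∃ A c C, D = A ++ c :: (!c) :: C ∧ A.count true = j ∧ A.count false = i) := by
  by_cases h : ∃ A c C, D = A ++ c :: (!c) :: C ∧ A.count true = j ∧ A.count false = i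
  · exact Or.inl h
  · refine Or.inr ⟨?_, h⟩
    unfold flip2
    split_ifs with h1
    · have key : ∀ c C, D.drop (i+j) = c :: (!c) :: C → False := by
        intro c C e
        apply h
        refine ⟨D.take (i+j), c, C, ?_, h1, ?_⟩
        · rw [← e, List.take_append_drop]
        · have h2 := count_tf (D.take (i+j))
          have h3 := congrArg List.length e
          rw [List.length_take] at h2
          rw [List.length_drop, List.length_cons, List.length_cons] at h3
          omega
      split
      · exact (key true _ (by assumption)).elim
      · exact (key false _ (by assumption)).elim
      · rfl
    · rfl

theorem flip2_flip2 (i j : ℕ) (D : List Bool) : flip2 i j (flip2 i j D) = D := by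
  rcases flip2_cases i j D with ⟨A, c, C, rfl, h1, h2⟩ | ⟨h, -⟩
  · rw [flip2_eq i j A C c h1 h2]
    have := flip2_eq i j A C (!c) h1 h2
    simpa using this
  · rw [h, h]

theorem flip2_mem (n i j : ℕ) (hij : i + 2 ≤ j) (D : List Bool) (hD : D ∈ dyckWords n) :
    flip2 i j D ∈ dyckWords n := by
  rcases flip2_cases i j D with ⟨A, c, C, rfl, h1, h2⟩ | ⟨h, -⟩
  · rw [flip2_eq i j A C c h1 h2]
    rw [mem_dyck] at hD ⊢
    obtain ⟨ht, hf, hk⟩ := hD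
    refine ⟨?_, ?_, ?_⟩
    · rw [← ht]; cases c <;> simp [List.count_append]
    · rw [← hf]; cases c <;> simp [List.count_append]
    · intro k
      have := hk k
      rw [List.take_append] at this ⊢
      rcases Nat.lt_or_ge A.length k with hlt | hge
      · rw [List.take_of_length_le (by omega)] at this ⊢
        obtain ⟨m, hm⟩ : ∃ m, k - A.length = m + 1 := ⟨k - A.length - 1, by omega⟩
        rw [hm] at this ⊢
        cases m with
        | zero => cases c <;> simp [List.count_append] at this ⊢ <;> omega
        | succ m =>
          cases c <;> simp [List.count_append] at this ⊢ <;> omega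
      · have h0 : k - A.length = 0 := by omega
        simpa [h0] using this
  · rwa [h]

theorem lab_adj (n : ℕ) (D : List Bool) (hD : D ∈ dyckWords n) (P : List ℕ) (x y : ℕ) (Q : List ℕ)
    (e : lab 0 0 D = P ++ x :: y :: Q) :
    y = x + 1 ∨ ∃ A c C, D = A ++ c :: (!c) :: C ∧ lab 0 0 A = P ∧
      A.count false ≤ A.count true ∧
      ((x = A.count true ∧ y = A.count false) ∨ (y = A.count true ∧ x = A.count false)) := by
  obtain ⟨A, C, rfl, h1, h2⟩ := lab_split _ _ _ _ _ e
  rw [mem_dyck] at hD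
  have hA := hD.2.2 A.length
  simp at hA
  rcases C with _ | ⟨c, _ | ⟨d, C⟩⟩
  · simp [lab] at h2
  · cases c <;> simp [lab] at h2
  · cases c <;> cases d <;> simp [lab] at h2
    · left; omega
    · right; exact ⟨A, false, C, rfl, h1, hA, Or.inr ⟨h2.2.1.symm, h2.1.symm⟩⟩
    · right; exact ⟨A, true, C, rfl, h1, hA, Or.inl ⟨h2.1.symm, h2.2.1.symm⟩⟩
    · left; omega

theorem lab_last_ne (i j : ℕ) (hij : i + 2 ≤ j) (A : List Bool) (ha : A.count true = j)
    (hb : A.count false = i) (P : List ℕ) (x : ℕ) (e : lab 0 0 A = P ++ [x]) : x ≠ i ∧ x ≠ j := by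
  obtain ⟨A1, A2, rfl, hl1, hl2⟩ := lab_split _ _ _ _ _ e
  rcases A2 with _ | ⟨d, _ | ⟨d', A3⟩⟩
  · simp [lab] at hl2
  · cases d <;> simp [lab] at hl2 ha hb <;> omega
  · cases d <;> cases d' <;> simp [lab] at hl2

theorem lab_head_ne (i j : ℕ) (hij : i + 2 ≤ j) (C : List Bool) (y : ℕ) (Q : List ℕ)
    (e : lab (j+1) (i+1) C = y :: Q) : y ≠ i ∧ y ≠ j := by
  rcases C with _ | ⟨d, C⟩
  · simp [lab] at e
  · cases d <;> simp [lab] at e <;> omega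

theorem des_flip (n i j : ℕ) (hij : i + 2 ≤ j) (v v' : ℕ → ℕ)
    (h1 : v' i = v j) (h2 : v' j = v i) (h3 : ∀ x, x ≠ i → x ≠ j → v' x = v x)
    (h4 : ∀ x < n, ∀ y < n, ¬ (x = i ∧ y = j) → ¬ (x = j ∧ y = i) → (v x < v y ↔ v' x < v' y))
    (D : List Bool) (hD : D ∈ dyckWords n) :
    des ((lab 0 0 D).map v) = des ((lab 0 0 (flip2 i j D)).map v') := by
  rcases flip2_cases i j D with ⟨A, c, C, rfl, ha, hb⟩ | ⟨h, hno⟩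
  · rw [flip2_eq i j A C c ha hb]
    have hlt := lab_mem_lt n _ hD
    have hadj := lab_adj n _ hD
    obtain ⟨p, q, hpq, hv1, hv2, el, er⟩ : ∃ p q : ℕ, ((p = i ∧ q = j) ∨ (p = j ∧ q = i)) ∧
        v' q = v p ∧ v' p = v q ∧
        lab 0 0 (A ++ c :: (!c) :: C) = lab 0 0 A ++ p :: q :: lab (j+1) (i+1) C ∧
        lab 0 0 (A ++ (!c) :: c :: C) = lab 0 0 A ++ q :: p :: lab (j+1) (i+1) C := by
      cases c
      · exact ⟨i, j, Or.inl ⟨rfl, rfl⟩, h2, h1, by simp [lab_append, lab, ha, hb],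
          by simp [lab_append, lab, ha, hb]⟩
      · exact ⟨j, i, Or.inr ⟨rfl, rfl⟩, h1, h2, by simp [lab_append, lab, ha, hb],
          by simp [lab_append, lab, ha, hb]⟩
    rw [el] at hlt hadj
    rw [el, er]
    -- adjacent pairs inside the prefix or the suffix
    have hpair : ∀ P x y Q, lab 0 0 A ++ p :: q :: lab (j+1) (i+1) C = P ++ x :: y :: Q →
        P.length ≠ A.length → (v y < v x ↔ v' y < v' x) := by
      intro P x y Q e hP
      have hx : x < n := hlt x (by rw [e]; simp)
      have hy : y < n := hlt y (by rw [e]; simp)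
      rcases hadj P x y Q e with h | ⟨A', c', C', e', hl', hle, hxy⟩
      · exact h4 y hy x hx (by omega) (by omega)
      · have hlen : A'.length = P.length := by rw [← hl', lab_length]
        have t1 := count_tf A
        have t2 := count_tf A'
        exact h4 y hy x hx (by omega) (by omega)
    have hA := lab_last_ne i j hij A ha hb
    have hC := lab_head_ne i j hij C
    have g1 : des ((lab 0 0 A).map v ++ [v p]) = des ((lab 0 0 A).map v' ++ [v p]) := by
      rcases List.eq_nil_or_concat (lab 0 0 A) with e | ⟨P, x, e⟩
      · simp [e]
      · rw [List.concat_eq_append] at e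
        obtain ⟨hxi, hxj⟩ := hA P x e
        have : des ((lab 0 0 A).map v) = des ((lab 0 0 A).map v') := by
          apply des_map_congr
          intro P x y Q e
          apply hpair P x y (Q ++ p :: q :: lab (j+1) (i+1) C) (by rw [e]; simp)
          have := congrArg List.length e
          rw [lab_length] at this
          simp at this
          omega
        rw [e] at this ⊢
        simp only [List.map_append, List.map_cons, List.map_nil, h3 x hxi hxj] at this ⊢
        simp only [List.append_assoc, List.cons_append, List.nil_append]
        rw [des_split _ (v x) [v p], this, ← des_split]
    have g2 : des (v q :: (lab (j+1) (i+1) C).map v) = des (v q :: (lab (j+1) (i+1) C).map v') := by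
      cases e : lab (j+1) (i+1) C with
      | nil => simp
      | cons y Q =>
        obtain ⟨hyi, hyj⟩ := hC y Q e
        have : des ((lab (j+1) (i+1) C).map v) = des ((lab (j+1) (i+1) C).map v') := by
          apply des_map_congr
          intro P x y Q e
          apply hpair (lab 0 0 A ++ p :: q :: P) x y Q (by rw [e]; simp)
          simp [lab_length]
        rw [e] at this
        simp only [List.map_cons, h3 y hyi hyj, des_cons_cons] at this ⊢
        rw [this]
    simp only [List.map_append, List.map_cons, hv1, hv2]
    rw [des_split, des_cons_cons, g1, g2, des_split (List.map v' (lab 0 0 A)) (v p) (v q :: _),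
      des_cons_cons]
  · rw [h]
    apply des_map_congr
    intro P x y Q e
    have hx : x < n := lab_mem_lt n _ hD x (by rw [e]; simp)
    have hy : y < n := lab_mem_lt n _ hD y (by rw [e]; simp)
    rcases lab_adj n _ hD P x y Q e with h | ⟨A', c', C', e', hl', hle, hxy⟩
    · exact h4 y hy x hx (by omega) (by omega)
    · have : ¬ (A'.count true = j ∧ A'.count false = i) :=
        fun hh => hno ⟨A', c', C', e', hh.1, hh.2⟩
      exact h4 y hy x hx (by omega) (by omega)

theorem plat_cons_cons (x y : ℕ) (r : List ℕ) :
    plat (x :: y :: r) = (if y = x then 1 else 0) + plat (y :: r) := by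
  by_cases h : y = x
  · simp [plat, h, Nat.add_comm]
  · simp [plat, h]

theorem plat_single (x : ℕ) : plat [x] = 0 := by simp [plat]

theorem plat_split (P : List ℕ) (x : ℕ) (Q : List ℕ) :
    plat (P ++ x :: Q) = plat (P ++ [x]) + plat (x :: Q) := by
  induction P with
  | nil => simp [plat_single]
  | cons a P ih =>
    cases P with
    | nil => simp [plat_cons_cons, plat_single]
    | cons b P =>
      simp only [List.cons_append, plat_cons_cons] at ih ⊢
      omega

theorem plat_flip (i j : ℕ) (hij : i + 2 ≤ j) (D : List Bool) :
    plat (lab 0 0 D) = plat (lab 0 0 (flip2 i j D)) := by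
  rcases flip2_cases i j D with ⟨A, c, C, rfl, ha, hb⟩ | ⟨h, hno⟩
  · rw [flip2_eq i j A C c ha hb]
    have hA := lab_last_ne i j hij A ha hb
    have hC := lab_head_ne i j hij C
    have g1 : ∀ p, (p = i ∨ p = j) → plat (lab 0 0 A ++ [p]) = plat (lab 0 0 A) := by
      intro p hp
      rcases List.eq_nil_or_concat (lab 0 0 A) with e | ⟨P, x, e⟩
      · rw [e]; simp [plat]
      · rw [List.concat_eq_append] at e
        have hx := hA P x e
        rw [e, List.append_assoc, List.cons_append, List.nil_append, plat_split, plat_cons_cons,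
          plat_single, if_neg (by omega)]
        omega
    have g2 : ∀ p, (p = i ∨ p = j) →
        plat (p :: lab (j+1) (i+1) C) = plat (lab (j+1) (i+1) C) := by
      intro p hp
      cases e : lab (j+1) (i+1) C with
      | nil => simp [plat]
      | cons y Q =>
        have hy := hC y Q e
        rw [plat_cons_cons, if_neg (by omega)]
        omega
    have key : ∀ p q, (p = i ∨ p = j) → (q = i ∨ q = j) → p ≠ q →
        plat (lab 0 0 A ++ p :: q :: lab (j+1) (i+1) C) =
          plat (lab 0 0 A) + plat (lab (j+1) (i+1) C) := by
      intro p q hp hq hpq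
      rw [plat_split, plat_cons_cons, g1 p hp, g2 q hq, if_neg (by omega)]
      omega
    cases c <;> simp only [lab_append, lab, ha, hb, Bool.not_true, Bool.not_false, Nat.zero_add]
    · rw [key i j (by simp) (by simp) (by omega), key j i (by simp) (by simp) (by omega)]
    · rw [key i j (by simp) (by simp) (by omega), key j i (by simp) (by simp) (by omega)]
  · rw [h]

theorem des_range_flip (n i j : ℕ) (hij : i + 2 ≤ j) (v v' : ℕ → ℕ)
    (h4 : ∀ x < n, ∀ y < n, ¬ (x = i ∧ y = j) → ¬ (x = j ∧ y = i) → (v x < v y ↔ v' x < v' y)) :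
    des ((List.range n).map v) = des ((List.range n).map v') := by
  apply des_map_congr
  intro P x y Q e
  have hx : x ∈ List.range n := by rw [e]; simp
  have hy : y ∈ List.range n := by rw [e]; simp
  have := range_pairs n P x y Q e
  exact h4 y (List.mem_range.1 hy) x (List.mem_range.1 hx) (by omega) (by omega)

theorem goodV_flip (n i j : ℕ) (hij : i + 2 ≤ j) (v v' : ℕ → ℕ)
    (h1 : v' i = v j) (h2 : v' j = v i) (h3 : ∀ x, x ≠ i → x ≠ j → v' x = v x)
    (h4 : ∀ x < n, ∀ y < n, ¬ (x = i ∧ y = j) → ¬ (x = j ∧ y = i) → (v x < v y ↔ v' x < v' y)) :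
    GoodV n v ↔ GoodV n v' := by
  unfold GoodV
  rw [des_range_flip n i j hij v v' h4]
  have : (∑ D ∈ dyckWords n, (MvPolynomial.X 0 : MvPolynomial (Fin 2) ℚ) ^
        des ((lab 0 0 D).map v) * (MvPolynomial.X 1) ^ plat (lab 0 0 D)) =
      (∑ D ∈ dyckWords n, (MvPolynomial.X 0 : MvPolynomial (Fin 2) ℚ) ^
        des ((lab 0 0 D).map v') * (MvPolynomial.X 1) ^ plat (lab 0 0 D)) := by
    refine Finset.sum_nbij' (flip2 i j) (flip2 i j) (fun D hD => flip2_mem n i j hij D hD)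
      (fun D hD => flip2_mem n i j hij D hD) (fun D _ => flip2_flip2 i j D)
      (fun D _ => flip2_flip2 i j D) ?_
    intro D hD
    rw [des_flip n i j hij v v' h1 h2 h3 h4 D hD, plat_flip i j hij D]
  rw [this]

theorem idxOf_mid (p q : List ℕ) (i j : ℕ) (hi : i ∉ p) (hj : j ∉ p) (hij : i ≠ j) :
    (p ++ i :: j :: q).idxOf i = p.length ∧ (p ++ i :: j :: q).idxOf j = p.length + 1 ∧
    ∀ x, x ≠ i → x ≠ j → ((p ++ i :: j :: q).idxOf x < p.length ∨
      p.length + 1 < (p ++ i :: j :: q).idxOf x) ∧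
      (p ++ i :: j :: q).idxOf x = (p ++ j :: i :: q).idxOf x := by
  refine ⟨?_, ?_, ?_⟩
  · simp [List.idxOf_append_of_notMem hi]
  · rw [List.idxOf_append_of_notMem hj, List.idxOf_cons_ne _ hij]
    simp
  · intro x hxi hxj
    by_cases hx : x ∈ p
    · rw [List.idxOf_append_of_mem hx, List.idxOf_append_of_mem hx]
      exact ⟨Or.inl (List.idxOf_lt_length_of_mem hx), rfl⟩
    · rw [List.idxOf_append_of_notMem hx, List.idxOf_append_of_notMem hx,
        List.idxOf_cons_ne _ hxi.symm, List.idxOf_cons_ne _ hxj.symm,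
        List.idxOf_cons_ne _ hxj.symm, List.idxOf_cons_ne _ hxi.symm]
      exact ⟨Or.inr (by omega), rfl⟩

theorem good_swap_lt (n : ℕ) (p q : List ℕ) (i j : ℕ) (hi : i ∉ p) (hj : j ∉ p)
    (hij : i + 2 ≤ j) : GoodL n (p ++ i :: j :: q) ↔ GoodL n (p ++ j :: i :: q) := by
  obtain ⟨a1, a2, a3⟩ := idxOf_mid p q i j hi hj (by omega)
  obtain ⟨b1, b2, b3⟩ := idxOf_mid p q j i hj hi (by omega)
  unfold GoodL
  apply goodV_flip n i j hij
  · rw [b2, a2]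
  · rw [b1, a1]
  · intro x hxi hxj; exact (a3 x hxi hxj).2.symm
  · intro x _ y _ hxy hyx
    have hx := a3 x
    have hy := a3 y
    by_cases x1 : x = i
    · subst x1
      by_cases y1 : y = x
      · subst y1; simp
      · have := hy y1 (by tauto)
        simp only [a1, b2]; omega
    · by_cases x2 : x = j
      · subst x2
        by_cases y1 : y = x
        · subst y1; simp
        · have := hy (by tauto) y1
          simp only [a2, b1]; omega
      · have hx := hx x1 x2
        by_cases y1 : y = i
        · subst y1; simp only [a1, b2]; omega
        · by_cases y2 : y = j
          · subst y2; simp only [a2, b1]; omega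
          · have := hy y1 y2
            omega

theorem good_swap (n : ℕ) (p q : List ℕ) (i j : ℕ) (hi : i ∉ p) (hj : j ∉ p)
    (hij : i + 2 ≤ j ∨ j + 2 ≤ i) : GoodL n (p ++ i :: j :: q) ↔ GoodL n (p ++ j :: i :: q) := by
  rcases hij with h | h
  · exact good_swap_lt n p q i j hi hj h
  · exact (good_swap_lt n p q j i hj hi h).symm

/-! ### All linear orders are connected -/

/-- Move one letter to the right through a list of commuting letters. -/
theorem good_move1 (n : ℕ) (p X q : List ℕ) (i : ℕ) (hX : ∀ x ∈ X, i + 2 ≤ x)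
    (hp : (p ++ i :: X ++ q).Perm (List.range n)) :
    GoodL n (p ++ i :: X ++ q) ↔ GoodL n (p ++ X ++ i :: q) := by
  induction X generalizing p with
  | nil => simp
  | cons x X ih =>
    have hnd : (p ++ i :: (x :: X) ++ q).Nodup := hp.nodup_iff.2 List.nodup_range
    have hi : i ∉ p := by
      intro h
      simp [List.nodup_append] at hnd
      have := (hnd.2.2 i h).1
      tauto
    have hx : x ∉ p := by
      intro h
      simp [List.nodup_append] at hnd
      have := (hnd.2.2 x h).2.1
      tauto
    have h1 := good_swap n p (X ++ q) i x hi hx (Or.inl (hX x (by simp)))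
    have hperm : (p ++ [x] ++ i :: X ++ q).Perm (p ++ i :: (x :: X) ++ q) := by
      simp only [List.append_assoc, List.cons_append, List.nil_append]
      exact List.Perm.append_left p (List.Perm.swap _ _ _)
    have h2 := ih (p ++ [x]) (fun y hy => hX y (by simp [hy])) (hperm.trans hp)
    simp only [List.append_assoc, List.cons_append, List.nil_append] at h1 h2 ⊢
    rw [h1, h2]

theorem good_move (n : ℕ) (p B X q : List ℕ) (hX : ∀ b ∈ B, ∀ x ∈ X, b + 2 ≤ x)
    (hp : (p ++ B ++ X ++ q).Perm (List.range n)) :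
    GoodL n (p ++ B ++ X ++ q) ↔ GoodL n (p ++ X ++ B ++ q) := by
  induction B generalizing p with
  | nil => simp
  | cons b B ih =>
    have h2 := ih (p ++ [b]) (fun y hy => hX y (by simp [hy])) (by simpa using hp)
    have hperm : (p ++ b :: X ++ (B ++ q)).Perm (p ++ (b :: B) ++ X ++ q) := by
      simp only [List.append_assoc, List.cons_append]
      apply List.Perm.append_left p
      apply List.Perm.cons
      rw [← List.append_assoc, ← List.append_assoc]
      exact List.Perm.append_right q List.perm_append_comm
    have h1 := good_move1 n p X (B ++ q) b (hX b (by simp)) (hperm.trans hp)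
    simp only [List.append_assoc, List.cons_append, List.nil_append] at h1 h2 ⊢
    rw [h2, h1]

theorem good_rots (n : ℕ) (hn : 1 ≤ n) (X l : List ℕ) (hp : (X ++ l).Perm (List.range n)) :
    GoodL n (X ++ l) ↔ GoodL n (l ++ X) := by
  induction X generalizing l with
  | nil => simp
  | cons x X ih =>
    have h1 := good_rot n hn x (X ++ l) hp
    have hperm : (X ++ (l ++ [x])).Perm (x :: X ++ l) := by
      rw [← List.append_assoc]
      exact List.perm_append_comm
    have h2 := ih (l ++ [x]) (hperm.trans hp)
    simp only [List.append_assoc, List.cons_append, List.nil_append] at h1 h2 ⊢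
    rw [h1, h2]

theorem good_block (n : ℕ) (hn : 1 ≤ n) (m k : ℕ) (hk : k + m = n) (l : List ℕ)
    (hp : (List.range k ++ l).Perm (List.range n)) : GoodL n (List.range k ++ l) := by
  induction m generalizing k l with
  | zero =>
    have hl : l = [] := by
      have := hp.length_eq
      simp at this
      exact List.length_eq_zero_iff.1 (by omega)
    subst hl
    have hkn : k = n := by omega
    subst hkn
    rw [List.append_nil]
    unfold GoodL
    rw [goodV_congr k _ id]
    · exact goodV_id k
    · intro x hx y hy
      have : ∀ z < k, (List.range k).idxOf z = z := by
        intro z hz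
        have := List.Nodup.idxOf_getElem (List.nodup_range (n := k)) z (by simpa using hz)
        simpa using this
      simp [this x hx, this y hy]
  | succ m ih =>
    have hmem : k ∈ l := by
      have : k ∈ List.range k ++ l := hp.mem_iff.2 (List.mem_range.2 (by omega))
      simpa using this
    have hnd : (List.range k ++ l).Nodup := hp.nodup_iff.2 List.nodup_range
    obtain ⟨X, Y, rfl⟩ := List.append_of_mem hmem
    have hX : ∀ x ∈ X, k + 1 ≤ x := by
      intro x hx
      rw [List.nodup_append] at hnd
      obtain ⟨-, h2, h3⟩ := hnd
      have h4 : x ≠ k := by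
        rw [List.nodup_append] at h2
        exact h2.2.2 x hx k (by simp)
      have h5 : ¬ x < k := fun h => h3 x (by simpa using h) x (by simp [hx]) rfl
      omega
    have hM := good_move n [] (List.range k) X (k :: Y)
      (by intro b hb x hx
          have := List.mem_range.1 hb
          have := hX x hx
          omega) (by simpa using hp)
    simp only [List.nil_append, List.append_assoc] at hM
    rw [hM]
    have hperm1 : (X ++ (List.range k ++ k :: Y)).Perm (List.range k ++ (X ++ k :: Y)) := by
      rw [← List.append_assoc, ← List.append_assoc]
      exact List.Perm.append_right _ List.perm_append_comm
    rw [good_rots n hn X _ (hperm1.trans hp)]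
    have e : (List.range k ++ k :: Y) ++ X = List.range (k+1) ++ (Y ++ X) := by
      simp [List.range_succ]
    rw [e]
    apply ih (k+1) (by omega)
    rw [← e]
    exact List.perm_append_comm.trans (hperm1.trans hp)

theorem good_all (n : ℕ) (hn : 1 ≤ n) (l : List ℕ) (hp : l.Perm (List.range n)) : GoodL n l :=
  good_block n hn n 0 (by omega) l (by simpa using hp)

/-! ### Permutations of one copy of each letter -/

theorem baseWord_one (n : ℕ) : baseWord n 1 = (List.range n).map (· + 1) := by
  unfold baseWord
  generalize List.range n = w
  induction w with
  | nil => rfl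
  | cons a w ih => rw [List.flatMap_cons, ih]; simp

theorem mem_multi1 (n : ℕ) (σ : List ℕ) :
    σ ∈ multiPerms n 1 ↔ σ.Perm ((List.range n).map (· + 1)) := by
  simp [multiPerms, List.mem_permutations, baseWord_one]

theorem base_nodup (n : ℕ) : ((List.range n).map (· + 1)).Nodup :=
  List.Nodup.map (fun a b h => by simpa using h) List.nodup_range

theorem map_getD_range (n : ℕ) (σ : List ℕ) (h : σ.Perm ((List.range n).map (· + 1))) :
    (List.range n).map (fun i => σ.getD i 0) = σ := by
  have hl : σ.length = n := by simpa using h.length_eq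
  apply List.ext_getElem
  · simp [hl]
  · intro i h1 h2
    simp [h2]

theorem getD_inj (n : ℕ) (σ : List ℕ) (h : σ.Perm ((List.range n).map (· + 1)))
    (x : ℕ) (hx : x < n) (y : ℕ) (hy : y < n) (e : σ.getD x 0 = σ.getD y 0) : x = y := by
  have hl : σ.length = n := by simpa using h.length_eq
  have hnd : σ.Nodup := h.nodup_iff.2 (base_nodup n)
  have hx' : x < σ.length := by omega
  have hy' : y < σ.length := by omega
  simp only [List.getD_eq_getElem _ _ hx', List.getD_eq_getElem _ _ hy'] at e
  exact (hnd.getElem_inj_iff).1 e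

theorem goodV_sigma (n : ℕ) (hn : 1 ≤ n) (σ : List ℕ)
    (h : σ.Perm ((List.range n).map (· + 1))) : GoodV n (fun i => σ.getD i 0) := by
  have hl : σ.length = n := by simpa using h.length_eq
  have hnd : σ.Nodup := h.nodup_iff.2 (base_nodup n)
  have hmem : ∀ k < n, k + 1 ∈ σ := by
    intro k hk
    rw [h.mem_iff]
    simpa using hk
  set l := (List.range n).map (fun k => σ.idxOf (k+1)) with hldef
  have hlnd : l.Nodup := by
    apply List.Nodup.map_on _ List.nodup_range
    intro x hx y hy e
    have := (List.idxOf_inj (hmem x (List.mem_range.1 hx))).1 e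
    omega
  have hlp : l.Perm (List.range n) := by
    apply List.Subperm.perm_of_length_le
    · apply hlnd.subperm
      intro x hx
      rw [hldef, List.mem_map] at hx
      obtain ⟨k, hk, rfl⟩ := hx
      rw [List.mem_range, ← hl]
      exact List.idxOf_lt_length_of_mem (hmem k (List.mem_range.1 hk))
    · simp [hldef]
  have key : ∀ i < n, l.idxOf i + 1 = σ.getD i 0 := by
    intro i hi
    have hi' : i < σ.length := by omega
    rw [List.getD_eq_getElem _ _ hi']
    have h1 : σ[i] ∈ (List.range n).map (· + 1) := h.mem_iff.1 (List.getElem_mem hi')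
    rw [List.mem_map] at h1
    obtain ⟨k, hk, hke⟩ := h1
    have hk' : k < l.length := by simpa [hldef] using hk
    have h2 : l[k] = i := by
      simp only [hldef, List.getElem_map, List.getElem_range]
      rw [hke]
      exact hnd.idxOf_getElem i hi'
    have h3 := hlnd.idxOf_getElem k hk'
    rw [h2] at h3
    omega
  have hg := good_all n hn l hlp
  unfold GoodL at hg
  rw [goodV_congr n _ (fun i => l.idxOf i)]
  · exact hg
  · intro x hx y hy
    have h1 := key x hx
    have h2 := key y hy
    simp only [← h1, ← h2]
    omega

/-! ### Nonnesting permutations as pairs -/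

/-- `Sp q r s w`: reading the steps `s`, with queue `q` of open letters and `r` of fresh letters,
spells `w`. -/
inductive Sp : List ℕ → List ℕ → List Bool → List ℕ → Prop
  | nil : Sp [] [] [] []
  | E (q r s w x) : Sp (q ++ [x]) r s w → Sp q (x :: r) (true :: s) (x :: w)
  | N (q r s w y) : Sp q r s w → Sp (y :: q) r (false :: s) (y :: w)

theorem Sp.counts {q r s w} (h : Sp q r s w) :
    s.count true = r.length ∧ s.count false = q.length + r.length ∧
      ∀ k, (s.take k).count false ≤ q.length + (s.take k).count true := by
  induction h with
  | nil => simp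
  | E q r s w x _ ih =>
    obtain ⟨h1, h2, h3⟩ := ih
    simp at h1 h2 h3
    refine ⟨by simp [h1], by simp [h2]; omega, ?_⟩
    intro k
    cases k with
    | zero => simp
    | succ k => have := h3 k; simp; omega
  | N q r s w x _ ih =>
    obtain ⟨h1, h2, h3⟩ := ih
    refine ⟨by simp [h1], by simp [h2]; omega, ?_⟩
    intro k
    cases k with
    | zero => simp
    | succ k => have := h3 k; simp; omega

theorem Sp.eq_lab {q r s w} (h : Sp q r s w) (p : List ℕ) :
    w = (lab (p.length + q.length) p.length s).map (fun i => (p ++ q ++ r).getD i 0) := by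
  induction h generalizing p with
  | nil => simp [lab]
  | E q r s w x _ ih =>
    have := ih p
    simp only [lab, List.map_cons]
    rw [List.length_append, ← Nat.add_assoc] at this
    simp only [List.append_assoc, List.cons_append, List.nil_append] at this ⊢
    congr 1
    rw [List.getD_eq_getElem?_getD, ← List.append_assoc,
      List.getElem?_append_right (by simp)]
    simp
  | N q r s w y _ ih =>
    have := ih (p ++ [y])
    simp only [lab, List.map_cons]
    rw [List.length_append] at this
    simp only [List.append_assoc, List.cons_append, List.nil_append, List.length_cons,
      List.length_nil, Nat.zero_add] at this ⊢
    rw [show p.length + (q.length + 1) = p.length + 1 + q.length by omega]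
    congr 1
    simp

theorem Sp.perm {q r s w} (h : Sp q r s w) : w.Perm (q ++ (r ++ r)) := by
  rw [List.perm_iff_count]
  intro a
  induction h with
  | nil => simp
  | E q r s w x _ ih =>
    simp only [List.count_append, List.count_cons, List.count_nil] at ih ⊢
    omega
  | N q r s w x _ ih =>
    simp only [List.count_append, List.count_cons, List.count_nil] at ih ⊢
    omega

theorem Sp.unique {q r s w} (h : Sp q r s w) (hnd : (q ++ r).Nodup) :
    ∀ r' s', Sp q r' s' w → (q ++ r').Nodup → r = r' ∧ s = s' := by
  induction h with
  | nil => intro r' s' h' _; cases h'; simp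
  | E q r s w x _ ih =>
    intro r' s' h' hnd'
    cases h' with
    | E _ r'' s'' _ _ h'' =>
      have := ih (by simpa using hnd) _ _ h'' (by simpa using hnd')
      simp [this.1, this.2]
    | N q' _ s'' _ _ h'' => simp at hnd
  | N q r s w y _ ih =>
    intro r' s' h' hnd'
    cases h' with
    | E _ r'' s'' _ _ h'' => simp at hnd'
    | N q' _ s'' _ _ h'' =>
      have := ih (List.nodup_cons.1 hnd).2 _ _ h'' (List.nodup_cons.1 hnd').2
      simp [this.1, this.2]

theorem Sp.exists (s : List Bool) (q r : List ℕ) (h1 : s.count true = r.length)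
    (h2 : s.count false = q.length + r.length)
    (h3 : ∀ k, (s.take k).count false ≤ q.length + (s.take k).count true) :
    ∃ w, Sp q r s w := by
  induction s generalizing q r with
  | nil =>
    simp at h1 h2
    have hr : r = [] := List.length_eq_zero_iff.1 h1.symm
    have hq : q = [] := List.length_eq_zero_iff.1 (by omega)
    subst hr; subst hq
    exact ⟨_, Sp.nil⟩
  | cons c s ih =>
    cases c
    · cases q with
      | nil => have := h3 1; simp at this
      | cons y q =>
        obtain ⟨w, hw⟩ := ih q r (by simpa using h1) (by simp at h2; omega)
          (by intro k; have := h3 (k+1); simp at this; omega)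
        exact ⟨_, Sp.N _ _ _ _ _ hw⟩
    · cases r with
      | nil => simp at h1
      | cons x r =>
        obtain ⟨w, hw⟩ := ih (q ++ [x]) r (by simpa using h1) (by simp at h2 ⊢; omega)
          (by intro k; have := h3 (k+1); simp at this ⊢; omega)
        exact ⟨_, Sp.E _ _ _ _ _ hw⟩

/-- Avoidance in terms of sublists. -/
theorem avoids_iff (w : List ℕ) :
    avoids w ↔ ∀ x y, [x, y, y, x].Sublist w → x = y := by
  constructor
  · intro h x y hs
    rw [List.sublist_iff_exists_fin_orderEmbedding_get_eq] at hs
    obtain ⟨f, hf⟩ := hs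
    have l01 : f ⟨0, by simp⟩ < f ⟨1, by simp⟩ := f.lt_iff_lt.2 (by simp [Fin.lt_def])
    have l12 : f ⟨1, by simp⟩ < f ⟨2, by simp⟩ := f.lt_iff_lt.2 (by simp [Fin.lt_def])
    have l23 : f ⟨2, by simp⟩ < f ⟨3, by simp⟩ := f.lt_iff_lt.2 (by simp [Fin.lt_def])
    have e0 := hf ⟨0, by simp⟩
    have e1 := hf ⟨1, by simp⟩
    have e2 := hf ⟨2, by simp⟩
    have e3 := hf ⟨3, by simp⟩
    simp at e0 e1 e2 e3
    have := h (f ⟨0, by simp⟩) (f ⟨1, by simp⟩) (f ⟨2, by simp⟩) (f ⟨3, by simp⟩) l01 l12 l23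
      (f ⟨3, by simp⟩).2
    simp only [List.getD_eq_getElem _ _ (Fin.is_lt _)] at this
    rw [e0, e1]
    exact this (e0.symm.trans e3) (e1.symm.trans e2)
  · intro h i j l m hij hjl hlm hm e1 e2
    have hi : i < w.length := by omega
    have hj : j < w.length := by omega
    have hl : l < w.length := by omega
    apply h
    have : [w.getD i 0, w.getD j 0, w.getD j 0, w.getD i 0] =
        ([⟨i, hi⟩, ⟨j, hj⟩, ⟨l, hl⟩, ⟨m, hm⟩] : List (Fin w.length)).map (w[·]) := by
      simp only [List.map_cons, List.map_nil, Fin.getElem_fin]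
      rw [← List.getD_eq_getElem w 0 hi, ← List.getD_eq_getElem w 0 hj,
        ← List.getD_eq_getElem w 0 hl, ← List.getD_eq_getElem w 0 hm, ← e1, ← e2]
    rw [this]
    apply List.map_getElem_sublist
    simp only [List.pairwise_cons, List.mem_cons, List.not_mem_nil, or_false, forall_eq_or_imp,
      forall_eq, Fin.mk_lt_mk, List.Pairwise.nil, and_true, false_imp_iff, implies_true]
    omega

theorem avoids_sublist {w w' : List ℕ} (h : w'.Sublist w) (hw : avoids w) : avoids w' := by
  rw [avoids_iff] at hw ⊢
  exact fun x y hs => hw x y (hs.trans h)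

theorem Sp.avoid {q r s w} (h : Sp q r s w) (hnd : (q ++ r).Nodup) : avoids (q ++ w) := by
  induction h with
  | nil => rw [avoids_iff]; intro x y h; simp at h
  | E q r s w x _ ih => simpa using ih (by simpa using hnd)
  | N q r s w y hs ih =>
    have hnd' := List.nodup_cons.1 hnd
    have ih' := ih hnd'.2
    have hyq : y ∉ q := fun h => hnd'.1 (by simp [h])
    have hyw : y ∉ w := by
      intro h
      have := hs.perm.mem_iff.1 h
      apply hnd'.1
      simp at this ⊢
      tauto
    have hqnd : q.Nodup := (List.nodup_append.1 hnd'.2).1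
    rw [avoids_iff] at ih' ⊢
    intro a b hab
    by_contra hne
    by_cases ha : a = y
    · subst ha
      rw [List.cons_append, List.cons_sublist_cons] at hab
      -- the last letter must be the inner occurrence
      have h1 : ([b, b, a]).reverse.Sublist (q ++ a :: w).reverse := List.reverse_sublist.2 hab
      simp only [List.reverse_append, List.reverse_cons, List.append_assoc, List.reverse_nil,
        List.nil_append, List.cons_append] at h1
      have h2 : ([b, b]).Sublist q.reverse := by
        rw [List.sublist_append_iff] at h1
        obtain ⟨l1, l2, e, hl1, hl2⟩ := h1
        cases l1 with
        | nil =>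
          simp at e
          subst e
          rwa [List.cons_sublist_cons] at hl2
        | cons z l1 =>
          simp at e
          exfalso
          apply hyw
          have : z ∈ w.reverse := hl1.subset (by simp)
          rw [e.1]
          simpa using this
      have h3 : [b, b].Nodup := h2.nodup (List.nodup_reverse.2 hqnd)
      simp at h3
    · by_cases hb : b = y
      · subst hb
        rw [List.cons_append] at hab
        have h1 : [a, b, b, a].Sublist (q ++ b :: w) := by
          rcases List.sublist_cons_iff.1 hab with h | ⟨r, e, _⟩
          · exact h
          · simp at e; exact (ha e.1).elim
        have h2 := h1.count_le b
        have c1 : q.count b = 0 := List.count_eq_zero.2 hyq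
        have c2 : w.count b = 0 := List.count_eq_zero.2 hyw
        simp [List.count_cons, c1, c2, ha] at h2
      · apply hne
        apply ih' a b
        have h1 := hab.filter (fun z => decide (z ≠ y))
        have f1 : q.filter (fun z => decide (z ≠ y)) = q := by
          rw [List.filter_eq_self]; intro z hz
          simp; rintro rfl; exact hyq hz
        have f2 : w.filter (fun z => decide (z ≠ y)) = w := by
          rw [List.filter_eq_self]; intro z hz
          simp; rintro rfl; exact hyw hz
        rw [List.filter_append, List.filter_cons (x := y), List.filter_cons (x := y), f1, f2] at h1
        simpa [ha, hb] using h1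

theorem Sp.of_avoid (w q : List ℕ) (hq : q.Nodup) (hav : avoids (q ++ w))
    (hc : ∀ a, (q ++ w).count a = 0 ∨ (q ++ w).count a = 2) :
    ∃ r s, Sp q r s w ∧ (q ++ r).Nodup := by
  induction w generalizing q with
  | nil =>
    have : q = [] := by
      cases q with
      | nil => rfl
      | cons y q =>
        have h1 := hc y
        have h2 := List.nodup_iff_count_le_one.1 hq y
        simp only [List.append_nil] at h1
        have h3 : 0 < (y :: q).count y := List.count_pos_iff.2 (by simp)
        omega
    subst this
    exact ⟨[], [], Sp.nil, by simp⟩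
  | cons x w ih =>
    by_cases hx : x ∈ q
    · cases q with
      | nil => simp at hx
      | cons y q =>
        have hnd' := List.nodup_cons.1 hq
        by_cases hxy : x = y
        · subst hxy
          have hcx := hc x
          have hxw : x ∉ w := by
            intro h
            have := List.count_pos_iff.2 h
            simp [List.count_append] at hcx
            omega
          obtain ⟨r, s, hs, hnd⟩ := ih q hnd'.2
            (avoids_sublist ((List.Sublist.append (List.sublist_cons_self x q)
              (List.sublist_cons_self x w))) hav)
            (by intro a
                have := hc a
                by_cases ha : a = x
                · subst ha
                  left
                  rw [List.count_eq_zero]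
                  simp [hxw, hnd'.1]
                · simp only [List.count_append, List.count_cons] at this ⊢
                  simp [Ne.symm ha] at this ⊢
                  exact this)
          refine ⟨r, _, Sp.N _ _ _ _ _ hs, ?_⟩
          rw [List.cons_append, List.nodup_cons]
          refine ⟨?_, hnd⟩
          intro h
          rcases List.mem_append.1 h with h | h
          · exact hnd'.1 h
          · apply hxw
            rw [hs.perm.mem_iff]
            simp [h]
        · exfalso
          have hxq : x ∈ q := by simpa [hxy] using hx
          have hyw : y ∈ w := by
            have h1 := hc y
            have h2 : q.count y = 0 := List.count_eq_zero.2 hnd'.1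
            simp [List.count_append, List.count_cons, h2, hxy] at h1
            exact List.count_pos_iff.1 (by omega)
          rw [avoids_iff] at hav
          apply hxy
          refine (hav y x ?_).symm
          have s1 : [y, x].Sublist (y :: q) :=
            List.cons_sublist_cons.2 (List.singleton_sublist.2 hxq)
          have s2 : [x, y].Sublist (x :: w) :=
            List.cons_sublist_cons.2 (List.singleton_sublist.2 hyw)
          exact s1.append s2
    · obtain ⟨r, s, hs, hnd⟩ := ih (q ++ [x])
        (by rw [List.nodup_append]
            refine ⟨hq, by simp, ?_⟩
            intro a ha b hb
            simp at hb
            subst hb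
            rintro rfl
            exact hx ha) (by simpa using hav) (by simpa using hc)
      exact ⟨_, _, Sp.E _ _ _ _ _ hs, by simpa using hnd⟩

theorem count_base2 (n : ℕ) (a : ℕ) :
    (baseWord n 2).count a = 2 * ((List.range n).map (· + 1)).count a := by
  unfold baseWord
  generalize List.range n = w
  induction w with
  | nil => rfl
  | cons b w ih =>
    simp only [List.flatMap_cons, List.count_append, ih, List.map_cons, List.count_cons,
      List.count_replicate]
    split_ifs <;> omega

theorem mem_nonnest (n : ℕ) (π : List ℕ) : π ∈ nonnest n ↔
    (∀ a, π.count a = 2 * ((List.range n).map (· + 1)).count a) ∧ avoids π := by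
  simp only [nonnest, multiPerms, Finset.mem_filter, List.mem_toFinset, List.mem_permutations,
    List.perm_iff_count, count_base2]

theorem sp_word (n : ℕ) (σ : List ℕ) (D : List Bool)
    (hσ : σ.Perm ((List.range n).map (· + 1))) (hD : D ∈ dyckWords n) :
    Sp [] σ D ((lab 0 0 D).map (fun i => σ.getD i 0)) := by
  have hl : σ.length = n := by simpa using hσ.length_eq
  rw [mem_dyck] at hD
  obtain ⟨w, hw⟩ := Sp.exists D [] σ (by rw [hD.1, hl]) (by rw [hD.2.1]; simp [hl])
    (by intro k; have := hD.2.2 k; simpa using this)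
  have := hw.eq_lab []
  simp at this
  simp only [List.getD_eq_getElem?_getD]
  rw [← this]
  exact hw

theorem sum_nonnest (n : ℕ) (f : List ℕ → MvPolynomial (Fin 2) ℚ) :
    ∑ π ∈ nonnest n, f π = ∑ σ ∈ multiPerms n 1, ∑ D ∈ dyckWords n,
      f ((lab 0 0 D).map (fun i => σ.getD i 0)) := by
  rw [← Finset.sum_product']
  symm
  apply Finset.sum_bij (fun (p : List ℕ × List Bool) _ =>
    (lab 0 0 p.2).map (fun i => p.1.getD i 0))
  · rintro ⟨σ, D⟩ hp
    rw [Finset.mem_product, mem_multi1] at hp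
    have hs := sp_word n σ D hp.1 hp.2
    have hnd : σ.Nodup := hp.1.nodup_iff.2 (base_nodup n)
    rw [mem_nonnest]
    refine ⟨?_, by simpa using hs.avoid (by simpa using hnd)⟩
    intro a
    have h1 := List.perm_iff_count.1 hs.perm a
    have h2 := List.perm_iff_count.1 hp.1 a
    rw [h1, ← h2]
    simp [List.count_append]
    omega
  · rintro ⟨σ, D⟩ hp ⟨σ', D'⟩ hp' e
    rw [Finset.mem_product, mem_multi1] at hp hp'
    have hs := sp_word n σ D hp.1 hp.2
    have hs' := sp_word n σ' D' hp'.1 hp'.2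
    have hnd : σ.Nodup := hp.1.nodup_iff.2 (base_nodup n)
    have hnd' : σ'.Nodup := hp'.1.nodup_iff.2 (base_nodup n)
    simp only at e
    rw [← e] at hs'
    have := hs.unique (by simpa using hnd) _ _ hs' (by simpa using hnd')
    rw [this.1, this.2]
  · intro π hπ
    rw [mem_nonnest] at hπ
    obtain ⟨hc, hav⟩ := hπ
    obtain ⟨r, s, hs, hnd⟩ := Sp.of_avoid π [] (by simp) (by simpa using hav)
      (by intro a
          have h1 := List.nodup_iff_count_le_one.1 (base_nodup n) a
          rw [List.nil_append, hc a]
          omega)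
    have hr : r.Perm ((List.range n).map (· + 1)) := by
      rw [List.perm_iff_count]
      intro a
      have h1 := List.perm_iff_count.1 hs.perm a
      rw [hc a] at h1
      simp only [List.nil_append, List.count_append] at h1
      omega
    have hl : r.length = n := by simpa using hr.length_eq
    have hD : s ∈ dyckWords n := by
      rw [mem_dyck]
      obtain ⟨h1, h2, h3⟩ := hs.counts
      refine ⟨by omega, by simp at h2; omega, ?_⟩
      intro k
      have := h3 k
      simpa using this
    refine ⟨(r, s), ?_, ?_⟩
    · rw [Finset.mem_product, mem_multi1]
      exact ⟨hr, hD⟩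
    · have := hs.eq_lab []
      simp at this
      simp only [List.getD_eq_getElem?_getD]
      exact this.symm
  · intro p _
    rfl

/-- Main theorem: C_n(t,u) = A_n(t) · N_n(t,u). -/
theorem Cpoly_eq_Apoly_mul_Npoly (n : ℕ) (hn : 1 ≤ n) :
    (∑ π ∈ nonnest n, (MvPolynomial.X 0 : MvPolynomial (Fin 2) ℚ) ^ des π * (MvPolynomial.X 1) ^ plat π)
      = (∑ σ ∈ multiPerms n 1, (MvPolynomial.X 0 : MvPolynomial (Fin 2) ℚ) ^ des σ) * Npoly n := by
  rw [sum_nonnest n, Finset.sum_mul]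
  apply Finset.sum_congr rfl
  intro σ hσ
  rw [mem_multi1] at hσ
  have h1 := goodV_sigma n hn σ hσ
  unfold GoodV at h1
  rw [map_getD_range n σ hσ] at h1
  rw [← h1]
  apply Finset.sum_congr rfl
  intro D hD
  rw [plat_map]
  intro x hx y hy hxy
  exact getD_inj n σ hσ x (lab_mem_lt n D hD x hx) y (lab_mem_lt n D hD y hy) hxy
end

section
/- The distribution of the number of weak descents on nonnesting permutations of {1,1,...,n,n} is symmetric: the number of nonnesting permutations with r weak descents equals the number with 2n - r weak descents, for all r. -/
attribute [local instance] Classical.propDecidable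

namespace NNP

/-! ### Elementary facts on descents -/

lemma des_cons_cons (a b : ℕ) (t : List ℕ) :
    des (a :: b :: t) = (if b < a then 1 else 0) + des (b :: t) := by
  unfold des
  by_cases h : b < a <;> simp [h, add_comm]

lemma wdes_cons_cons (a b : ℕ) (t : List ℕ) :
    wdes (a :: b :: t) = (if b ≤ a then 1 else 0) + wdes (b :: t) := by
  unfold wdes
  by_cases h : b ≤ a
  · simp [h, add_comm]
  · simp [h]

lemma des_append (l : List ℕ) (x y : ℕ) :
    des (l ++ [x, y]) = des (l ++ [x]) + (if y < x then 1 else 0) := by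
  induction l with
  | nil => simp [des_cons_cons]; simp [des]
  | cons a l ih =>
    cases l with
    | nil => simp [des_cons_cons]; simp [des]
    | cons b l =>
      simp only [List.cons_append, des_cons_cons] at ih ⊢
      omega

lemma des_reverse (w : List ℕ) (hw : w ≠ []) : des w.reverse + wdes w + 1 = w.length := by
  induction w with
  | nil => simp at hw
  | cons a w ih =>
    cases w with
    | nil => simp [des, wdes]
    | cons b t =>
      have h := ih (by simp)
      have e : (a :: b :: t).reverse = t.reverse ++ [b, a] := by simp
      have e2 : (b :: t).reverse = t.reverse ++ [b] := by simp
      rw [e, des_append, wdes_cons_cons, ← e2]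
      simp only [List.length_cons] at h ⊢
      split_ifs <;> omega

/-! ### Avoidance through sublists -/

lemma avoids_iff (w : List ℕ) :
    avoids w ↔ ∀ a b, a ≠ b → ¬ List.Sublist [a, b, b, a] w := by
  constructor
  · intro h a b hab hs
    obtain ⟨f, hf⟩ := List.sublist_iff_exists_orderEmbedding_getElem?_eq.mp hs
    have h0 := hf 0
    have h1 := hf 1
    have h2 := hf 2
    have h3 := hf 3
    simp at h0 h1 h2 h3
    have hlt : f 3 < w.length := by
      by_contra hc
      rw [List.getElem?_eq_none (by omega)] at h3
      simp at h3
    have := h (f 0) (f 1) (f 2) (f 3) (by simp) (by simp) (by simp) hlt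
      (by simp [List.getD_eq_getElem?_getD, ← h0, ← h3])
      (by simp [List.getD_eq_getElem?_getD, ← h1, ← h2])
    simp [List.getD_eq_getElem?_getD, ← h0, ← h1] at this
    exact hab this
  · intro h i j l m hij hjl hlm hm h1 h2
    by_contra hne
    apply h _ _ hne
    have e : [w.getD i 0, w.getD j 0, w.getD j 0, w.getD i 0] =
        [(⟨i, by omega⟩ : Fin w.length), ⟨j, by omega⟩, ⟨l, by omega⟩, ⟨m, by omega⟩].map
          (fun k => w[k]) := by
      rw [List.getD_eq_getElem _ _ (by omega), List.getD_eq_getElem _ _ (by omega)] at h1 h2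
      rw [List.getD_eq_getElem _ _ (by omega), List.getD_eq_getElem _ _ (by omega)]
      simp [h1, h2]
    rw [e]
    apply List.map_getElem_sublist
    simp
    omega

lemma avoids_reverse (w : List ℕ) (h : avoids w) : avoids w.reverse := by
  rw [avoids_iff] at h ⊢
  intro a b hab hs
  apply h a b hab
  have := hs.reverse
  simpa using this

lemma mem_nonnest (n : ℕ) (w : List ℕ) :
    w ∈ nonnest n ↔ w.Perm (baseWord n 2) ∧ avoids w := by
  simp [nonnest, multiPerms]

lemma length_of_mem {n : ℕ} {w : List ℕ} (h : w ∈ nonnest n) : w.length = 2 * n := by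
  rw [mem_nonnest] at h
  rw [h.1.length_eq]
  simp [baseWord, mul_comm]

lemma count_baseWord (n c : ℕ) :
    (baseWord n 2).count c = if 1 ≤ c ∧ c ≤ n then 2 else 0 := by
  induction n with
  | zero => simp [baseWord]; omega
  | succ n ih =>
    have : baseWord (n+1) 2 = baseWord n 2 ++ [n+1, n+1] := by
      simp [baseWord, List.range_succ]
    rw [this, List.count_append, ih]
    by_cases hc : c = n + 1
    · subst hc; simp
    · have : List.count c [n+1, n+1] = 0 := by
        simp [List.count_eq_zero, hc]
      rw [this]
      split_ifs <;> omega

lemma pos_of_mem {n : ℕ} {w : List ℕ} (h : w ∈ nonnest n) : ∀ a ∈ w, 1 ≤ a := by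
  rw [mem_nonnest] at h
  intro a ha
  have h1 : 0 < (baseWord n 2).count a := by
    rw [← h.1.count_eq]; exact List.count_pos_iff.mpr ha
  rw [count_baseWord] at h1
  split_ifs at h1 with h2
  · exact h2.1
  · omega

lemma card_reverse (n r : ℕ) (hn : 1 ≤ n) (hr : r ≤ 2 * n) :
    ((nonnest n).filter (fun π => wdes π = 2 * n - r)).card =
    ((nonnest n).filter (fun π => des π + 1 = r)).card := by
  have key : ∀ w ∈ nonnest n, des w.reverse + wdes w + 1 = 2 * n := by
    intro w hw
    rw [des_reverse, length_of_mem hw]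
    intro h
    have := length_of_mem hw
    simp [h] at this
    omega
  have hrev : ∀ w ∈ nonnest n, w.reverse ∈ nonnest n := by
    intro w hw
    rw [mem_nonnest] at hw ⊢
    exact ⟨(List.reverse_perm w).trans hw.1, avoids_reverse _ hw.2⟩
  refine Finset.card_bij' (fun w _ => w.reverse) (fun w _ => w.reverse) ?_ ?_ ?_ ?_
  · intro w hw
    simp only [Finset.mem_filter] at hw ⊢
    refine ⟨hrev _ hw.1, ?_⟩
    have := key w hw.1
    omega
  · intro w hw
    simp only [Finset.mem_filter] at hw ⊢
    refine ⟨hrev _ hw.1, ?_⟩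
    have := key w.reverse (hrev _ hw.1)
    rw [List.reverse_reverse] at this
    omega
  · simp
  · simp

/-! ### Counting compatible value sequences -/

lemma hockey (p S m : ℕ) (hS : p = 0 → S = 0) (d : ℕ) : ∀ a, m - a = d →
    ∑ v ∈ Finset.Ico a m, (m + p - 1 - v - S).choose p = (m + p - a - S).choose (p + 1) := by
  induction d with
  | zero =>
    intro a ha
    rw [Finset.Ico_eq_empty (by omega), Finset.sum_empty, Nat.choose_eq_zero_of_lt (by omega)]
  | succ d ih =>
    intro a ha
    rw [Finset.sum_eq_sum_Ico_succ_bot (by omega), ih (a+1) (by omega)]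
    by_cases h : m + p - a - S = 0
    · have hp : p ≠ 0 := by
        intro h0
        have := hS h0
        omega
      rw [Nat.choose_eq_zero_of_lt (by omega), Nat.choose_eq_zero_of_lt (by omega),
        Nat.choose_eq_zero_of_lt (by omega)]
    · obtain ⟨k, hk⟩ := Nat.exists_eq_succ_of_ne_zero h
      rw [hk, Nat.choose_succ_succ]
      congr 2 <;> omega

/-- gap needed between consecutive values -/
noncomputable def gap (R : ℕ → ℕ → Prop) (prev b : ℕ) : ℕ := if R b prev then 1 else 0

/-- total of the gaps -/
noncomputable def tot (R : ℕ → ℕ → Prop) : ℕ → List ℕ → ℕ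
  | _, [] => 0
  | prev, b :: t => gap R prev b + tot R b t

/-- Labelled words -/
noncomputable def T (R : ℕ → ℕ → Prop) (m : ℕ) : ℕ → ℕ → List ℕ → Finset (List (ℕ × ℕ))
  | _, _, [] => {[]}
  | prev, lo, b :: t => (Finset.Ico (lo + gap R prev b) m).biUnion
      (fun v => (T R m b v t).image (fun l => (v, b) :: l))

lemma card_T (R : ℕ → ℕ → Prop) (m : ℕ) (w : List ℕ) : ∀ prev lo,
    (T R m prev lo w).card = (m + w.length - 1 - lo - tot R prev w).choose w.length := by
  induction w with
  | nil => simp [T]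
  | cons b t ih =>
    intro prev lo
    rw [T, Finset.card_biUnion]
    · have : ∀ v ∈ Finset.Ico (lo + gap R prev b) m,
          ((T R m b v t).image (fun l => (v, b) :: l)).card
            = (m + t.length - 1 - v - tot R b t).choose t.length := by
        intro v _
        rw [Finset.card_image_of_injective, ih]
        intro l l' h
        simpa using h
      rw [Finset.sum_congr rfl this, hockey _ _ _ _ _ _ rfl]
      · simp only [List.length_cons, tot]
        congr 1
        omega
      · intro h
        rw [List.length_eq_zero_iff] at h
        subst h
        simp [tot]
    · intro v _ v' _ hv
      rw [Function.onFun, Finset.disjoint_left]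
      intro l hl hl'
      simp only [Finset.mem_image] at hl hl'
      obtain ⟨l1, _, rfl⟩ := hl
      obtain ⟨l2, _, h⟩ := hl'
      simp at h
      exact hv h.1.symm

/-- relation between consecutive labelled letters -/
def rel (R : ℕ → ℕ → Prop) (p q : ℕ × ℕ) : Prop := p.1 + gap R p.2 q.2 ≤ q.1

lemma mem_T (R : ℕ → ℕ → Prop) (m : ℕ) (w : List ℕ) : ∀ prev lo L,
    L ∈ T R m prev lo w ↔ L.map Prod.snd = w ∧ (∀ p ∈ L, p.1 < m) ∧
      List.IsChain (rel R) ((lo, prev) :: L) := by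
  induction w with
  | nil =>
    intro prev lo L
    simp only [T, Finset.mem_singleton, List.map_eq_nil_iff]
    constructor
    · rintro rfl; simp
    · exact fun h => h.1
  | cons b t ih =>
    intro prev lo L
    simp only [T, Finset.mem_biUnion, Finset.mem_Ico, Finset.mem_image]
    constructor
    · rintro ⟨v, ⟨h1, h2⟩, l, hl, rfl⟩
      rw [ih] at hl
      obtain ⟨e1, e2, e3⟩ := hl
      refine ⟨by simp [e1], ?_, ?_⟩
      · simpa using ⟨h2, by simpa using e2⟩
      · rw [List.isChain_cons_cons]
        exact ⟨h1, e3⟩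
    · rintro ⟨e1, e2, e3⟩
      cases L with
      | nil => simp at e1
      | cons q L =>
        obtain ⟨v, c⟩ := q
        simp only [List.map_cons, List.cons.injEq] at e1
        obtain ⟨rfl, e1⟩ := e1
        rw [List.isChain_cons_cons] at e3
        refine ⟨v, ⟨e3.1, e2 (v, c) (by simp)⟩, L, ?_, rfl⟩
        rw [ih]
        exact ⟨e1, fun p hp => e2 p (by simp [hp]), e3.2⟩

lemma tot_des (w : List ℕ) : ∀ a, tot (fun x y => x < y) a w = des (a :: w) := by
  induction w with
  | nil => intro a; simp [tot, des]
  | cons b t ih => intro a; rw [tot, ih, des_cons_cons, gap]; congr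

lemma tot_wdes (w : List ℕ) : ∀ a, tot (fun x y => x ≤ y) a w = wdes (a :: w) := by
  induction w with
  | nil => intro a; simp [tot, wdes]
  | cons b t ih => intro a; rw [tot, ih, wdes_cons_cons, gap]; congr

lemma des_zero_cons (w : List ℕ) : des (0 :: w) = des w := by
  cases w with
  | nil => simp [des]
  | cons b t => rw [des_cons_cons]; simp

lemma wdes_zero_cons (w : List ℕ) (h : ∀ a ∈ w, 1 ≤ a) : wdes (0 :: w) = wdes w := by
  cases w with
  | nil => simp [wdes]
  | cons b t =>
    have := h b (by simp)
    rw [wdes_cons_cons, if_neg (by omega)]; simp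

/-! ### Sorted labelled words -/

/-- weak lexicographic order -/
def le' (p q : ℕ × ℕ) : Prop := p.1 < q.1 ∨ (p.1 = q.1 ∧ p.2 ≤ q.2)
/-- strict lexicographic order -/
def lt' (p q : ℕ × ℕ) : Prop := p.1 < q.1 ∨ (p.1 = q.1 ∧ p.2 < q.2)

instance : IsTrans (ℕ × ℕ) le' := ⟨by intro a b c; unfold le'; omega⟩
instance : IsTrans (ℕ × ℕ) lt' := ⟨by intro a b c; unfold lt'; omega⟩
instance : Std.Total le' := ⟨by intro a b; unfold le'; omega⟩
instance : Std.Antisymm le' :=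
  ⟨by intro a b h1 h2; unfold le' at *; apply Prod.ext <;> omega⟩

/-- weakly sorted labelled nonnesting words -/
def B (n m : ℕ) : Set (List (ℕ × ℕ)) :=
  {L | L.Pairwise le' ∧ L.map Prod.snd ∈ nonnest n ∧ ∀ p ∈ L, p.1 < m}
/-- strictly sorted labelled nonnesting words -/
def A (n m : ℕ) : Set (List (ℕ × ℕ)) :=
  {L | L.Pairwise lt' ∧ L.map Prod.snd ∈ nonnest n ∧ ∀ p ∈ L, p.1 < m}

lemma rel_lt : rel (fun x y => x < y) = le' := by
  funext p q
  unfold rel gap le'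
  split_ifs with h <;> simp only [eq_iff_iff] <;> omega

lemma rel_le : rel (fun x y => x ≤ y) = lt' := by
  funext p q
  unfold rel gap lt'
  split_ifs with h <;> simp only [eq_iff_iff] <;> omega

lemma card_biUnion_T (R : ℕ → ℕ → Prop) (n m : ℕ) :
    ((nonnest n).biUnion (fun w => T R m 0 0 w)).card
      = ∑ w ∈ nonnest n, (m + 2 * n - 1 - tot R 0 w).choose (2 * n) := by
  rw [Finset.card_biUnion]
  · apply Finset.sum_congr rfl
    intro w hw
    rw [card_T, length_of_mem hw]
    simp
  · intro w _ w' _ hne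
    rw [Function.onFun, Finset.disjoint_left]
    intro L h1 h2
    rw [mem_T] at h1 h2
    exact hne (h1.1.symm.trans h2.1)

lemma B_eq (n m : ℕ) :
    B n m = ((nonnest n).biUnion (fun w => T (fun x y => x < y) m 0 0 w) : Finset _) := by
  ext L
  simp only [B, Set.mem_setOf_eq, Finset.mem_coe, Finset.mem_biUnion, mem_T, rel_lt,
    List.isChain_iff_pairwise, List.pairwise_cons]
  constructor
  · rintro ⟨h1, h2, h3⟩
    refine ⟨_, h2, rfl, h3, ?_, h1⟩
    intro p _
    unfold le'
    simp only
    omega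
  · rintro ⟨w, hw, rfl, h3, _, h1⟩
    exact ⟨h1, hw, h3⟩

lemma A_eq (n m : ℕ) :
    A n m = ((nonnest n).biUnion (fun w => T (fun x y => x ≤ y) m 0 0 w) : Finset _) := by
  ext L
  simp only [A, Set.mem_setOf_eq, Finset.mem_coe, Finset.mem_biUnion, mem_T, rel_le,
    List.isChain_iff_pairwise, List.pairwise_cons]
  constructor
  · rintro ⟨h1, h2, h3⟩
    refine ⟨_, h2, rfl, h3, ?_, h1⟩
    intro p hp
    have := pos_of_mem h2 p.2 (List.mem_map_of_mem hp)
    unfold lt'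
    simp only
    omega
  · rintro ⟨w, hw, rfl, h3, _, h1⟩
    exact ⟨h1, hw, h3⟩

lemma ncard_B (n m : ℕ) :
    (B n m).ncard = ∑ w ∈ nonnest n, (m + 2 * n - (des w + 1)).choose (2 * n) := by
  rw [B_eq, Set.ncard_coe_finset, card_biUnion_T]
  apply Finset.sum_congr rfl
  intro w _
  rw [tot_des, des_zero_cons]
  congr 1
  omega

lemma ncard_A (n m : ℕ) :
    (A n (m + 1)).ncard = ∑ w ∈ nonnest n, (m + 2 * n - wdes w).choose (2 * n) := by
  rw [A_eq, Set.ncard_coe_finset, card_biUnion_T]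
  apply Finset.sum_congr rfl
  intro w hw
  rw [tot_wdes, wdes_zero_cons _ (pos_of_mem hw)]
  congr 1
  omega

/-! ### Sorted words and data -/

/-- letters of the labelled word with second entry c -/
abbrev filt (c : ℕ) (L : List (ℕ × ℕ)) : List (ℕ × ℕ) := L.filter (fun p => p.2 = c)

lemma count_map_snd (c : ℕ) (L : List (ℕ × ℕ)) :
    (L.map Prod.snd).count c = (filt c L).length := by
  rw [List.count, List.countP_map, List.countP_eq_length_filter]
  congr 1

lemma count_filt (z : ℕ × ℕ) (L : List (ℕ × ℕ)) : (filt z.2 L).count z = L.count z := by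
  rw [List.count_filter]; simp

lemma count_filter' (z : ℕ × ℕ) (q : ℕ × ℕ → Bool) (L : List (ℕ × ℕ)) :
    (L.filter q).count z = if q z then L.count z else 0 := by
  split_ifs with h
  · exact List.count_filter h
  · rw [List.count_eq_zero]
    intro hm
    exact h (List.mem_filter.mp hm).2

lemma perm_of_filt {L L' : List (ℕ × ℕ)} (h : ∀ c, filt c L = filt c L') : L.Perm L' := by
  rw [List.perm_iff_count]
  intro z
  rw [← count_filt, h, count_filt]

variable {n : ℕ}

/-- sorted word associated to data -/
noncomputable def toL (d : (Fin n → ℕ) × (Fin n → ℕ)) : List (ℕ × ℕ) :=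
  List.insertionSort le'
    ((List.finRange n).flatMap (fun a => [(d.1 a, a.1 + 1), (d.2 a, a.1 + 1)]))

lemma toL_sorted (d : (Fin n → ℕ) × (Fin n → ℕ)) : (toL d).Pairwise le' :=
  List.pairwise_insertionSort _ _

lemma toL_perm (d : (Fin n → ℕ) × (Fin n → ℕ)) : (toL d).Perm
    ((List.finRange n).flatMap (fun a => [(d.1 a, a.1 + 1), (d.2 a, a.1 + 1)])) :=
  List.perm_insertionSort _ _

lemma sorted_ext {L L' : List (ℕ × ℕ)} (h : L.Perm L') (h1 : L.Pairwise le')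
    (h2 : L'.Pairwise le') : L = L' :=
  h.eq_of_pairwise (fun _ _ _ _ h1 h2 => antisymm_of le' h1 h2) h1 h2

lemma flatMap_filter_aux (d : (Fin n → ℕ) × (Fin n → ℕ)) (a : Fin n) (l : List (Fin n))
    (hl : l.Nodup) :
    filt (a.1 + 1) (l.flatMap (fun a => [(d.1 a, a.1 + 1), (d.2 a, a.1 + 1)]))
      = if a ∈ l then [(d.1 a, a.1 + 1), (d.2 a, a.1 + 1)] else [] := by
  induction l with
  | nil => simp
  | cons b l ih =>
    rw [List.nodup_cons] at hl
    have ih := ih hl.2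
    unfold filt at ih ⊢
    rw [List.flatMap_cons, List.filter_append, ih]
    by_cases hab : a = b
    · subst hab
      simp [hl.1]
    · have : b.1 ≠ a.1 := fun h => hab (Fin.ext h.symm)
      simp [hab, this]

lemma filt_toL (d : (Fin n → ℕ) × (Fin n → ℕ)) (h : ∀ a, d.1 a ≤ d.2 a) (a : Fin n) :
    filt (a.1 + 1) (toL d) = [(d.1 a, a.1 + 1), (d.2 a, a.1 + 1)] := by
  apply sorted_ext
  · have := (toL_perm d).filter (fun p => p.2 = a.1 + 1)
    refine this.trans ?_
    have h2 := flatMap_filter_aux d a _ (List.nodup_finRange n)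
    unfold filt at h2
    rw [h2]
    simp
  · exact (toL_sorted d).filter _
  · have := h a
    simp [le']
    omega

lemma filt_toL_out (d : (Fin n → ℕ) × (Fin n → ℕ)) (c : ℕ) (hc : ¬ (1 ≤ c ∧ c ≤ n)) :
    filt c (toL d) = [] := by
  rw [filt, List.filter_eq_nil_iff]
  intro p hp
  rw [(toL_perm d).mem_iff] at hp
  simp only [List.mem_flatMap, List.mem_finRange, true_and] at hp
  obtain ⟨a, ha⟩ := hp
  have := a.2
  simp at ha
  rcases ha with rfl | rfl <;> simp <;> omega

/-- compatibility -/
def compat (d : (Fin n → ℕ) × (Fin n → ℕ)) : Prop :=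
  ∀ a b : Fin n, ¬ (lt' (d.1 a, a.1) (d.1 b, b.1) ∧ lt' (d.2 b, b.1) (d.2 a, a.1))

lemma avoids_toL (d : (Fin n → ℕ) × (Fin n → ℕ)) (h : ∀ a, d.1 a ≤ d.2 a) :
    avoids ((toL d).map Prod.snd) ↔ compat d := by
  rw [avoids_iff]
  constructor
  · rintro hav a b ⟨h1, h2⟩
    have hab : a.1 ≠ b.1 := by
      intro hab
      have hab := Fin.ext hab
      subst hab
      unfold lt' at h1
      simp at h1
    apply hav (a.1 + 1) (b.1 + 1) (by omega)
    have hs : ([(d.1 a, a.1+1), (d.1 b, b.1+1), (d.2 b, b.1+1), (d.2 a, a.1+1)]).Sublist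
        (toL d) := by
      have e : (toL d).filter (fun p => p.2 = a.1 + 1 ∨ p.2 = b.1 + 1) =
          [(d.1 a, a.1+1), (d.1 b, b.1+1), (d.2 b, b.1+1), (d.2 a, a.1+1)] := by
        apply sorted_ext
        · have e1 : (toL d |>.filter (fun p => p.2 = a.1 + 1 ∨ p.2 = b.1 + 1)).Perm
              (filt (a.1+1) (toL d) ++ filt (b.1+1) (toL d)) := by
            rw [List.perm_iff_count]
            intro z
            rw [List.count_append, count_filter', count_filter', count_filter']
            by_cases h3 : z.2 = a.1 + 1
            · have h4 : z.2 ≠ b.1 + 1 := by omega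
              simp [h3, hab]
            · simp [h3]
          refine e1.trans ?_
          rw [filt_toL d h, filt_toL d h]
          rw [List.perm_iff_count]
          intro z
          simp only [List.cons_append, List.nil_append, List.count_cons, List.count_nil]
          omega
        · exact (toL_sorted d).filter _
        · have := h a
          have := h b
          unfold lt' at h1 h2
          simp only at h1 h2
          simp [le']
          omega
      rw [← e]
      exact List.filter_sublist
    have := hs.map Prod.snd
    simpa using this
  · intro hc x y hxy hs
    obtain ⟨l, hl, e⟩ := List.sublist_map_iff.mp hs
    have hsort := (toL_sorted d).sublist hl
    have hrange : ∀ p ∈ l, ∃ a : Fin n, p.2 = a.1 + 1 := by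
      intro p hp
      have := hl.subset hp
      rw [(toL_perm d).mem_iff] at this
      simp only [List.mem_flatMap, List.mem_finRange, true_and] at this
      obtain ⟨a, ha⟩ := this
      refine ⟨a, ?_⟩
      simp at ha
      rcases ha with rfl | rfl <;> rfl
    have hl4 : l.length = 4 := by
      have := congrArg List.length e
      simpa using this.symm
    match l, hl4 with
    | [p, q, r, s], _ =>
      simp only [List.map_cons, List.map_nil, List.cons.injEq, and_true] at e
      obtain ⟨e1, e2, e3, e4⟩ := e
      obtain ⟨a, ha⟩ := hrange p (by simp)
      obtain ⟨b, hb⟩ := hrange q (by simp)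
      have f1 := hl.filter (fun p => p.2 = a.1 + 1)
      have f2 := hl.filter (fun p => p.2 = b.1 + 1)
      have g1 := filt_toL d h a
      have g2 := filt_toL d h b
      unfold filt at g1 g2
      have k1 : r.2 = b.1 + 1 := by omega
      have k2 : s.2 = a.1 + 1 := by omega
      have hba : b.1 ≠ a.1 := by omega
      rw [g1] at f1
      rw [g2] at f2
      simp [ha, hb, k1, k2, hba, hba.symm] at f1 f2
      have f1 := f1.eq_of_length (by simp)
      have f2 := f2.eq_of_length (by simp)
      simp at f1 f2
      obtain ⟨rfl, rfl⟩ := f1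
      obtain ⟨rfl, rfl⟩ := f2
      simp [le'] at hsort
      apply hc a b
      unfold lt'
      simp only
      omega

/-- data with weak inequalities -/
def DB (n m : ℕ) : Set ((Fin n → ℕ) × (Fin n → ℕ)) :=
  {d | (∀ a, d.1 a ≤ d.2 a) ∧ (∀ a, d.2 a < m) ∧ compat d}
/-- data with strict inequalities -/
def DA (n m : ℕ) : Set ((Fin n → ℕ) × (Fin n → ℕ)) :=
  {d | (∀ a, d.1 a < d.2 a) ∧ (∀ a, d.2 a < m) ∧ compat d}

lemma toL_injOn : Set.InjOn (toL (n := n)) {d | ∀ a, d.1 a ≤ d.2 a} := by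
  intro d hd d' hd' e
  have key : ∀ a, d.1 a = d'.1 a ∧ d.2 a = d'.2 a := by
    intro a
    have h1 := filt_toL d hd a
    rw [e, filt_toL d' hd' a] at h1
    simp at h1
    exact ⟨h1.1.symm, h1.2.symm⟩
  apply Prod.ext
  · funext a; exact (key a).1
  · funext a; exact (key a).2

lemma toL_map_perm (d : (Fin n → ℕ) × (Fin n → ℕ)) (h : ∀ a, d.1 a ≤ d.2 a) :
    ((toL d).map Prod.snd).Perm (baseWord n 2) := by
  rw [List.perm_iff_count]
  intro c
  rw [count_map_snd, count_baseWord]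
  split_ifs with hc
  · have := filt_toL d h ⟨c - 1, by omega⟩
    have e : c - 1 + 1 = c := by omega
    simp only [e] at this
    rw [this]
    rfl
  · rw [filt_toL_out d c hc]; rfl

lemma toL_lt (d : (Fin n → ℕ) × (Fin n → ℕ)) (h : ∀ a, d.1 a ≤ d.2 a) (m : ℕ) :
    (∀ p ∈ toL d, p.1 < m) ↔ ∀ a, d.2 a < m := by
  constructor
  · intro hp a
    refine hp (d.2 a, a.1 + 1) ?_
    rw [(toL_perm d).mem_iff]
    simp only [List.mem_flatMap, List.mem_finRange, true_and]
    exact ⟨a, by simp⟩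
  · intro hd p hp
    rw [(toL_perm d).mem_iff] at hp
    simp only [List.mem_flatMap, List.mem_finRange, true_and] at hp
    obtain ⟨a, ha⟩ := hp
    have h1 := hd a
    have h2 := h a
    simp at ha
    rcases ha with rfl | rfl
    · exact lt_of_le_of_lt h2 h1
    · exact h1

lemma exists_data {L : List (ℕ × ℕ)} (hs : L.Pairwise le')
    (hL : (L.map Prod.snd).Perm (baseWord n 2)) :
    ∃ d : (Fin n → ℕ) × (Fin n → ℕ), (∀ a, d.1 a ≤ d.2 a) ∧ toL d = L := by
  have hlen : ∀ c, (filt c L).length = if 1 ≤ c ∧ c ≤ n then 2 else 0 := by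
    intro c
    rw [← count_map_snd, hL.count_eq, count_baseWord]
  have key : ∀ a : Fin n, ∃ u v : ℕ, u ≤ v ∧ filt (a.1+1) L = [(u, a.1+1), (v, a.1+1)] := by
    intro a
    have h2 : (filt (a.1+1) L).length = 2 := by
      rw [hlen, if_pos]
      have := a.2
      omega
    obtain ⟨p, q, hpq⟩ := List.length_eq_two.mp h2
    have hp : p ∈ filt (a.1+1) L := by rw [hpq]; simp
    have hq : q ∈ filt (a.1+1) L := by rw [hpq]; simp
    simp only [filt, List.mem_filter, decide_eq_true_eq] at hp hq
    have hs2 : (filt (a.1+1) L).Pairwise le' := hs.filter _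
    rw [hpq] at hs2
    simp [le'] at hs2
    refine ⟨p.1, q.1, by omega, ?_⟩
    rw [hpq, ← hp.2]
    simp only [Prod.mk.eta, List.cons.injEq, and_true, true_and]
    exact Prod.ext rfl (by rw [hq.2, hp.2])
  choose u v huv hf using key
  refine ⟨(u, v), huv, ?_⟩
  apply sorted_ext _ (toL_sorted _) hs
  apply perm_of_filt
  intro c
  by_cases hc : 1 ≤ c ∧ c ≤ n
  · have e : c = (⟨c - 1, by omega⟩ : Fin n).1 + 1 := by simp; omega
    rw [e, filt_toL (u, v) huv, hf]
  · rw [filt_toL_out _ c hc]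
    have := hlen c
    rw [if_neg hc, List.length_eq_zero_iff] at this
    exact this.symm

lemma toL_nodup (d : (Fin n → ℕ) × (Fin n → ℕ)) (h : ∀ a, d.1 a ≤ d.2 a) :
    (toL d).Nodup ↔ ∀ a, d.1 a < d.2 a := by
  constructor
  · intro hd a
    have h1 : (filt (a.1+1) (toL d)).Nodup := hd.filter _
    rw [filt_toL d h a] at h1
    simp at h1
    have := h a
    omega
  · intro hd
    rw [List.nodup_iff_count_le_one]
    intro z
    rw [← count_filt]
    by_cases hc : 1 ≤ z.2 ∧ z.2 ≤ n
    · have e : z.2 = (⟨z.2 - 1, by omega⟩ : Fin n).1 + 1 := by simp; omega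
      rw [e, filt_toL d h]
      apply List.nodup_iff_count_le_one.mp
      have := hd ⟨z.2 - 1, by omega⟩
      simp
      omega
    · rw [filt_toL_out _ _ hc]; simp

lemma image_DB (m : ℕ) : toL '' DB n m = B n m := by
  ext L
  constructor
  · rintro ⟨d, ⟨h1, h2, h3⟩, rfl⟩
    exact ⟨toL_sorted d, (mem_nonnest _ _).mpr ⟨toL_map_perm d h1, (avoids_toL d h1).mpr h3⟩,
      (toL_lt d h1 m).mpr h2⟩
  · rintro ⟨h1, h2, h3⟩
    rw [mem_nonnest] at h2
    obtain ⟨d, hd, rfl⟩ := exists_data h1 h2.1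
    exact ⟨d, ⟨hd, (toL_lt d hd m).mp h3, (avoids_toL d hd).mp h2.2⟩, rfl⟩

lemma A_iff (m : ℕ) (L : List (ℕ × ℕ)) : L ∈ A n m ↔ L ∈ B n m ∧ L.Nodup := by
  have : L.Pairwise lt' ↔ L.Pairwise le' ∧ L.Nodup := by
    rw [List.Nodup, ← List.pairwise_and_iff]
    apply List.Pairwise.iff
    intro p q
    unfold lt' le'
    rw [Ne, Prod.ext_iff]
    omega
  simp only [A, B, Set.mem_setOf_eq, this]
  tauto

lemma image_DA (m : ℕ) : toL '' DA n m = A n m := by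
  ext L
  rw [A_iff, ← image_DB]
  constructor
  · rintro ⟨d, ⟨h1, h2, h3⟩, rfl⟩
    have h1' : ∀ a, d.1 a ≤ d.2 a := fun a => (h1 a).le
    exact ⟨⟨d, ⟨h1', h2, h3⟩, rfl⟩, (toL_nodup d h1').mpr h1⟩
  · rintro ⟨⟨d, ⟨h1, h2, h3⟩, rfl⟩, h4⟩
    exact ⟨d, ⟨(toL_nodup d h1).mp h4, h2, h3⟩, rfl⟩

/-- raise the labels of the second copies -/
def shift (d : (Fin n → ℕ) × (Fin n → ℕ)) : (Fin n → ℕ) × (Fin n → ℕ) :=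
  (d.1, fun a => d.2 a + 1)

lemma compat_shift (d : (Fin n → ℕ) × (Fin n → ℕ)) : compat (shift d) ↔ compat d := by
  unfold compat shift lt'
  simp

lemma image_shift (m : ℕ) : shift '' DB n m = DA n (m + 1) := by
  ext d
  constructor
  · rintro ⟨d, ⟨h1, h2, h3⟩, rfl⟩
    refine ⟨?_, ?_, (compat_shift d).mpr h3⟩
    · intro a; have := h1 a; simp only [shift]; omega
    · intro a; have := h2 a; simp only [shift]; omega
  · rintro ⟨h1, h2, h3⟩
    have e : shift (d.1, fun a => d.2 a - 1) = d := by
      unfold shift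
      apply Prod.ext
      · rfl
      · funext a
        have := h1 a
        simp only
        omega
    refine ⟨(d.1, fun a => d.2 a - 1), ⟨?_, ?_, ?_⟩, e⟩
    · intro a; have := h1 a; simp only; omega
    · intro a; have := h1 a; have := h2 a; simp only; omega
    · rw [← compat_shift, e]; exact h3

lemma ncard_eq (n m : ℕ) : (A n (m + 1)).ncard = (B n m).ncard := by
  rw [← image_DA, ← image_DB, ← image_shift, Set.ncard_image_of_injOn, Set.ncard_image_of_injOn,
    Set.ncard_image_of_injOn]
  · exact toL_injOn.mono (fun d hd => hd.1)
  · intro d _ d' _ e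
    simp only [shift, Prod.mk.injEq] at e
    apply Prod.ext e.1
    funext a
    have := congrFun e.2 a
    simpa using this
  · rw [image_shift]
    exact toL_injOn.mono (fun d hd a => (hd.1 a).le)

lemma equidist {α : Type*} (s : Finset α) (f g : α → ℕ) (p : ℕ) (hp : 1 ≤ p)
    (h : ∀ m, ∑ w ∈ s, (m + p - f w).choose p = ∑ w ∈ s, (m + p - g w).choose p) (k : ℕ) :
    (s.filter (fun w => f w = k)).card = (s.filter (fun w => g w = k)).card := by
  induction k using Nat.strong_induction_on with
  | _ k ih =>
    have split : ∀ f : α → ℕ, ∑ w ∈ s, (k + p - f w).choose p =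
        ∑ j ∈ Finset.range k, (s.filter (fun w => f w = j)).card * (k + p - j).choose p
          + (s.filter (fun w => f w = k)).card := by
      intro f
      have e : ∀ w ∈ s, (k + p - f w).choose p =
          ∑ j ∈ Finset.range (k+1), if f w = j then (k + p - j).choose p else 0 := by
        intro w _
        rw [Finset.sum_ite_eq]
        split_ifs with hw
        · rfl
        · simp only [Finset.mem_range] at hw
          exact Nat.choose_eq_zero_of_lt (by omega)
      rw [Finset.sum_congr rfl e, Finset.sum_comm, Finset.sum_range_succ]
      congr 1
      · apply Finset.sum_congr rfl
        intro j _
        rw [← Finset.sum_filter, Finset.sum_const, smul_eq_mul]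
      · rw [← Finset.sum_filter, Finset.sum_const, smul_eq_mul]
        simp
    have h1 := h k
    rw [split f, split g] at h1
    have h2 : ∑ j ∈ Finset.range k, (s.filter (fun w => f w = j)).card * (k + p - j).choose p =
        ∑ j ∈ Finset.range k, (s.filter (fun w => g w = j)).card * (k + p - j).choose p := by
      apply Finset.sum_congr rfl
      intro j hj
      rw [ih j (Finset.mem_range.mp hj)]
    omega

end NNP

/-- The distribution of weak descents on nonnesting permutations is symmetric
around n. -/
theorem wdes_symmetric (n r : ℕ) (hr : r ≤ 2 * n) :
    ((nonnest n).filter (fun π => wdes π = r)).card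
      = ((nonnest n).filter (fun π => wdes π = 2 * n - r)).card := by
  rcases Nat.eq_zero_or_pos n with rfl | hn
  · have : r = 0 := by omega
    subst this
    rfl
  · rw [NNP.card_reverse n r hn hr]
    apply NNP.equidist _ _ _ (2 * n) (by omega)
    intro m
    rw [← NNP.ncard_A, ← NNP.ncard_B, NNP.ncard_eq]
end
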